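/- arXiv:1905.10842 — 2 statements merged into one kernel-verified Lean document; each statement's English description precedes it below -/
import Mathlib

section
/- Let 2 < α ≤ 3 and let u ∈ C^∞(S²) be a solution of −Δu + α = e^{2u} on S². If for every y ∈ S² the great circle C_y splits S² into two half-spheres of equal area for the conformal metric e^{2u}g, i.e. ∫_{H_y} e^{2u} dμ = ∫_{H_{−y}} e^{2u} dμ for all y ∈ S², then u is axially symmetric with respect to some point of S². -/
open MeasureTheory Real
open scoped RealInnerProductSpace ContDiff

noncomputable section

abbrev E3 : Type := EuclideanSpace ℝ (Fin 3)

/-- The unit sphere `S²` as a subset of `ℝ³`. -/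
def S2 : Set E3 := Metric.sphere 0 1

/-- The Euclidean Laplacian of `u : ℝ³ → ℝ`.  For a `0`-homogeneous function it
coincides on `S²` with the Laplace–Beltrami operator of the round metric applied
to the restriction of `u` to `S²`. -/
def lap (u : E3 → ℝ) (x : E3) : ℝ :=
  ∑ i : Fin 3, iteratedFDeriv ℝ 2 u x ![EuclideanSpace.single i 1, EuclideanSpace.single i 1]

/-- `u : ℝ³ → ℝ` is positively homogeneous of degree `0`, i.e. it is the radial
extension of a function on `S²`. -/
def Hom0 (u : E3 → ℝ) : Prop := ∀ (x : E3) (r : ℝ), 0 < r → u (r • x) = u x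

/-- `u` represents a smooth solution of the mean field equation `-Δ_{S²} u + α = e^{2u}`
on `S²`, encoded through its degree-zero homogeneous extension to `ℝ³ \ {0}`. -/
def MFE (u : E3 → ℝ) (α : ℝ) : Prop :=
  ContDiffOn ℝ ∞ u {(0 : E3)}ᶜ ∧ Hom0 u ∧
    ∀ x ∈ S2, -lap u x + α = Real.exp (2 * u x)

/-- Reflection of `ℝ³` across the plane `{x · y = 0}`. -/
def Refl (y x : E3) : E3 := x - (2 * ⟪x, y⟫) • y

/-- The closed half-sphere `H_y`. -/
def halfSphere (y : E3) : Set E3 := {x ∈ S2 | 0 ≤ ⟪x, y⟫}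

/-- The great circle `C_y`. -/
def circleOf (y : E3) : Set E3 := {x ∈ S2 | ⟪x, y⟫ = 0}

/-- `u` is axially symmetric with respect to `p`: on the sphere it depends only on `x · p`. -/
def AxiallySymmetric (u : E3 → ℝ) (p : E3) : Prop :=
  ∀ x ∈ S2, ∀ y ∈ S2, ⟪x, p⟫ = ⟪y, p⟫ → u x = u y

/-- `p` is an umbilical critical point of `u` (viewed as a function on `S²`):
the (intrinsic) gradient vanishes and the Hessian, as a quadratic form on the
tangent plane `p^⊥`, is a multiple of the metric. -/
def UmbilicalCritical (u : E3 → ℝ) (p : E3) : Prop :=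
  fderiv ℝ u p = 0 ∧
    ∃ c : ℝ, ∀ v : E3, ⟪v, p⟫ = 0 → iteratedFDeriv ℝ 2 u p ![v, v] = c * ‖v‖ ^ 2

/-- `z` is an eigenvector of the Hessian `D²u(q)` viewed as a symmetric bilinear
form on the tangent plane `q^⊥`. -/
def HessEigen (u : E3 → ℝ) (q z : E3) : Prop :=
  ∃ lam : ℝ, ∀ v : E3, ⟪v, q⟫ = 0 → iteratedFDeriv ℝ 2 u q ![z, v] = lam * ⟪z, v⟫

/-- Cross product on `ℝ³`. -/
def cross (a b : E3) : E3 :=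
  (WithLp.equiv 2 (Fin 3 → ℝ)).symm
    (crossProduct ((WithLp.equiv 2 (Fin 3 → ℝ)) a) ((WithLp.equiv 2 (Fin 3 → ℝ)) b))

/-- `Ω` is a nodal domain of `w` on the sphere: a connected component of
`S² \ w⁻¹(0)` (in the subspace topology of `S²`). -/
def IsNodalDomain (w : E3 → ℝ) (Ω : Set E3) : Prop :=
  ∃ x ∈ S2, w x ≠ 0 ∧ Ω = connectedComponentIn {z ∈ S2 | w z ≠ 0} x

end

section

/-- Smoothness away from the origin. -/
def SmoothOff (f : E3 → ℝ) : Prop := ContDiffOn ℝ ∞ f {(0 : E3)}ᶜ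

/-- The infinitesimal rotation about the axis `b i`. -/
noncomputable def rotGen (b : OrthonormalBasis (Fin 3) ℝ E3) (i : Fin 3) : E3 →L[ℝ] E3 :=
  (innerSL ℝ (b (i + 1))).smulRight (b (i + 2)) - (innerSL ℝ (b (i + 2))).smulRight (b (i + 1))

/-- The derivative along the infinitesimal rotation about the axis `b i`. -/
noncomputable def angDeriv (b : OrthonormalBasis (Fin 3) ℝ E3) (i : Fin 3) (f : E3 → ℝ)
    (x : E3) : ℝ :=
  fderiv ℝ f x (rotGen b i x)

variable {b : OrthonormalBasis (Fin 3) ℝ E3} {f g : E3 → ℝ} {x : E3} {i : Fin 3}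

lemma rotGen_apply (b : OrthonormalBasis (Fin 3) ℝ E3) (i : Fin 3) (x : E3) :
    rotGen b i x = ⟪b (i + 1), x⟫ • b (i + 2) - ⟪b (i + 2), x⟫ • b (i + 1) := by
  simp [rotGen]

lemma inner_basis (b : OrthonormalBasis (Fin 3) ℝ E3) (i j : Fin 3) :
    ⟪b i, b j⟫ = if i = j then 1 else 0 :=
  orthonormal_iff_ite.1 b.orthonormal i j

lemma SmoothOff.contDiffAt (hf : SmoothOff f) (hx : x ≠ 0) : ContDiffAt ℝ ∞ f x :=
  ContDiffOn.contDiffAt hf (isOpen_compl_singleton.mem_nhds hx)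

lemma SmoothOff.differentiableAt (hf : SmoothOff f) (hx : x ≠ 0) : DifferentiableAt ℝ f x :=
  (hf.contDiffAt hx).differentiableAt (by simp)

lemma SmoothOff.fderiv (hf : SmoothOff f) : ContDiffOn ℝ ∞ (fderiv ℝ f) {(0 : E3)}ᶜ :=
  ContDiffOn.fderiv_of_isOpen hf isOpen_compl_singleton (by simp)

lemma SmoothOff.differentiableAt_fderiv (hf : SmoothOff f) (hx : x ≠ 0) :
    DifferentiableAt ℝ (_root_.fderiv ℝ f) x :=
  (hf.fderiv.contDiffAt (isOpen_compl_singleton.mem_nhds hx)).differentiableAt (by simp)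

lemma SmoothOff.angDeriv (hf : SmoothOff f) (b : OrthonormalBasis (Fin 3) ℝ E3) (i : Fin 3) :
    SmoothOff (angDeriv b i f) :=
  ContDiffOn.clm_apply hf.fderiv (rotGen b i).contDiff.contDiffOn

lemma SmoothOff.continuousOn (hf : SmoothOff f) : ContinuousOn f {(0 : E3)}ᶜ :=
  ContDiffOn.continuousOn hf

lemma SmoothOff.sub (hf : SmoothOff f) (hg : SmoothOff g) : SmoothOff (fun x => f x - g x) :=
  ContDiffOn.sub hf hg

lemma SmoothOff.comp_isometry (hf : SmoothOff f) (A : E3 ≃ₗᵢ[ℝ] E3) :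
    SmoothOff (fun x => f (A x)) :=
  ContDiffOn.comp hf A.contDiff.contDiffOn fun x hx => by simpa using hx

lemma SmoothOff.second_symm (hf : SmoothOff f) (hx : x ≠ 0) (v w : E3) :
    _root_.fderiv ℝ (_root_.fderiv ℝ f) x v w = _root_.fderiv ℝ (_root_.fderiv ℝ f) x w v :=
  ((hf.contDiffAt hx).isSymmSndFDerivAt
    (by simpa using WithTop.coe_le_coe.2 (le_top (a := (2 : ℕ∞))))) v w

lemma Hom0.fderiv_smul (hf : Hom0 f) (x : E3) {r : ℝ} (hr : 0 < r) :
    fderiv ℝ f x = r • fderiv ℝ f (r • x) := by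
  rw [← fderiv_comp_smul]
  congr 1
  funext y
  exact (hf y r hr).symm

lemma Hom0.angDeriv (hf : Hom0 f) (b : OrthonormalBasis (Fin 3) ℝ E3) (i : Fin 3) :
    Hom0 (angDeriv b i f) := by
  intro x r hr
  simp only [_root_.angDeriv, hf.fderiv_smul x hr, map_smul, _root_.smul_apply]

lemma Hom0.sub (hf : Hom0 f) (hg : Hom0 g) : Hom0 (fun x => f x - g x) := by
  intro x r hr
  simp only [hf x r hr, hg x r hr]

lemma Hom0.fderiv_self (hf : Hom0 f) (hs : SmoothOff f) (hx : x ≠ 0) : fderiv ℝ f x x = 0 := by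
  have h1 : HasDerivAt (fun t : ℝ => t • x) x 1 := by
    simpa using (hasDerivAt_id (1 : ℝ)).smul_const x
  have hd : HasFDerivAt f (fderiv ℝ f x) ((1 : ℝ) • x) := by
    simpa using (hs.differentiableAt hx).hasFDerivAt
  have h2 := hd.comp_hasDerivAt (1 : ℝ) h1
  have h3 : HasDerivAt (f ∘ fun t : ℝ => t • x) 0 1 := by
    refine (hasDerivAt_const (1 : ℝ) (f x)).congr_of_eventuallyEq ?_
    filter_upwards [lt_mem_nhds (zero_lt_one (α := ℝ))] with t ht
    exact hf x t ht
  exact h2.unique h3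

lemma Hom0.second_self (hf : Hom0 f) (hs : SmoothOff f) (hx : x ≠ 0) (v : E3) :
    fderiv ℝ (fderiv ℝ f) x v x = - fderiv ℝ f x v := by
  have h1 : HasFDerivAt (fun y => fderiv ℝ f y y)
      ((fderiv ℝ f x).comp (ContinuousLinearMap.id ℝ E3)
        + (fderiv ℝ (fderiv ℝ f) x).flip x) x :=
    ((hs.differentiableAt_fderiv hx).hasFDerivAt).clm_apply (hasFDerivAt_id x)
  have h2 : HasFDerivAt (fun y => fderiv ℝ f y y) (0 : E3 →L[ℝ] ℝ) x := by
    refine (hasFDerivAt_const (0 : ℝ) x).congr_of_eventuallyEq ?_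
    filter_upwards [isOpen_compl_singleton.mem_nhds hx] with y hy
    exact hf.fderiv_self hs hy
  have h3 := congrArg (fun L : E3 →L[ℝ] ℝ => L v) (h1.unique h2)
  simp at h3
  linarith

lemma angDeriv_angDeriv (hf : SmoothOff f) (hx : x ≠ 0) (i j : Fin 3) :
    angDeriv b i (angDeriv b j f) x =
      fderiv ℝ (fderiv ℝ f) x (rotGen b i x) (rotGen b j x)
        + fderiv ℝ f x (rotGen b j (rotGen b i x)) := by
  have h1 : HasFDerivAt (angDeriv b j f)
      ((fderiv ℝ f x).comp (rotGen b j) + (fderiv ℝ (fderiv ℝ f) x).flip (rotGen b j x)) x :=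
    ((hf.differentiableAt_fderiv hx).hasFDerivAt).clm_apply (rotGen b j).hasFDerivAt
  rw [angDeriv, h1.fderiv]
  simp [add_comm]

lemma angDeriv_comm (hf : SmoothOff f) (hx : x ≠ 0) (i : Fin 3) :
    angDeriv b (i + 1) (angDeriv b i f) x =
      angDeriv b i (angDeriv b (i + 1) f) x + angDeriv b (i + 2) f x := by
  rw [angDeriv_angDeriv hf hx, angDeriv_angDeriv hf hx, hf.second_symm hx, add_assoc, angDeriv,
    ← map_add]
  congr 2
  simp only [rotGen_apply]
  fin_cases i <;>
    simp [inner_sub_right, inner_smul_right]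

lemma angDeriv_congr (h : ∀ x ≠ 0, f x = g x) (hx : x ≠ 0) :
    angDeriv b i f x = angDeriv b i g x := by
  have : f =ᶠ[nhds x] g := by
    filter_upwards [isOpen_compl_singleton.mem_nhds hx] with y hy using h y hy
  rw [angDeriv, angDeriv, this.fderiv_eq]

lemma angDeriv_add (hf : SmoothOff f) (hg : SmoothOff g) (hx : x ≠ 0) :
    angDeriv b i (fun y => f y + g y) x = angDeriv b i f x + angDeriv b i g x := by
  simp only [angDeriv]
  rw [fderiv_fun_add (hf.differentiableAt hx) (hg.differentiableAt hx)]
  rfl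

lemma angDeriv_sub (hf : SmoothOff f) (hg : SmoothOff g) (hx : x ≠ 0) :
    angDeriv b i (fun y => f y - g y) x = angDeriv b i f x - angDeriv b i g x := by
  simp only [angDeriv]
  rw [fderiv_fun_sub (hf.differentiableAt hx) (hg.differentiableAt hx)]
  rfl

lemma angDeriv_mul (hf : SmoothOff f) (hg : SmoothOff g) (hx : x ≠ 0) :
    angDeriv b i (fun y => f y * g y) x = f x * angDeriv b i g x + angDeriv b i f x * g x := by
  simp only [angDeriv]
  rw [fderiv_fun_mul (hf.differentiableAt hx) (hg.differentiableAt hx)]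
  simp [mul_comm]

lemma SmoothOff.exp_two_mul (hf : SmoothOff f) : SmoothOff (fun x => exp (2 * f x)) :=
  ContDiffOn.exp (contDiffOn_const.mul hf)

lemma angDeriv_exp_two_mul (hf : SmoothOff f) (hx : x ≠ 0) :
    angDeriv b i (fun y => exp (2 * f y)) x = exp (2 * f x) * (2 * angDeriv b i f x) := by
  have h := (((hf.differentiableAt hx).hasFDerivAt).const_mul (2 : ℝ)).exp
  rw [angDeriv, h.fderiv]
  simp [angDeriv]

/-- The Casimir operator commutes with infinitesimal rotations. -/
lemma sum_angDeriv_angDeriv_angDeriv (hf : SmoothOff f) (hx : x ≠ 0) (i : Fin 3) :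
    ∑ j, angDeriv b j (angDeriv b j (angDeriv b i f)) x =
      angDeriv b i (fun y => ∑ j, angDeriv b j (angDeriv b j f) y) x := by
  have e : ∀ (g : E3 → ℝ) (j : Fin 3), SmoothOff g → ∀ y ≠ 0,
      angDeriv b (j + 2) (angDeriv b j g) y =
        angDeriv b j (angDeriv b (j + 2) g) y - angDeriv b (j + 1) g y := by
    intro g j hg y hy
    have := angDeriv_comm (b := b) hg hy (j + 2)
    have h1 : j + 2 + 1 = j := by fin_cases j <;> rfl
    have h2 : j + 2 + 2 = j + 1 := by fin_cases j <;> rfl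
    rw [h1, h2] at this
    linarith
  have hS : ∀ F : Fin 3 → ℝ, ∑ j, F j = F i + F (i + 1) + F (i + 2) := by
    intro F
    fin_cases i <;> simp [Fin.sum_univ_three] <;> ring
  rw [hS]
  have hd := fun j : Fin 3 => hf.angDeriv b j
  have hdd := fun j : Fin 3 => (hd j).angDeriv b j
  have hadd : SmoothOff (fun y => angDeriv b i (angDeriv b i f) y
      + angDeriv b (i + 1) (angDeriv b (i + 1) f) y) := ContDiffOn.add (hdd i) (hdd (i + 1))
  rw [angDeriv_congr (g := fun y => (angDeriv b i (angDeriv b i f) y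
      + angDeriv b (i + 1) (angDeriv b (i + 1) f) y)
      + angDeriv b (i + 2) (angDeriv b (i + 2) f) y)
    (fun y _ => hS (fun j => angDeriv b j (angDeriv b j f) y)) hx,
    angDeriv_add hadd (hdd (i + 2)) hx, angDeriv_add (hdd i) (hdd (i + 1)) hx]
  rw [angDeriv_congr (i := i + 1) (fun y hy => angDeriv_comm (b := b) hf hy i) hx,
    angDeriv_add ((hd (i + 1)).angDeriv b i) (hd (i + 2)) hx,
    angDeriv_comm (hd (i + 1)) hx i,
    angDeriv_congr (i := i + 2) (fun y hy => e f i hf y hy) hx,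
    angDeriv_sub ((hd (i + 2)).angDeriv b i) (hd (i + 1)) hx, e _ i (hd (i + 2)) x hx]
  ring

lemma basis_sum (b : OrthonormalBasis (Fin 3) ℝ E3) (x : E3) :
    x = ⟪b 0, x⟫ • b 0 + ⟪b 1, x⟫ • b 1 + ⟪b 2, x⟫ • b 2 := by
  have := b.sum_repr' x
  rw [Fin.sum_univ_three] at this
  exact this.symm

lemma lap_eq_sum (b : OrthonormalBasis (Fin 3) ℝ E3) (f : E3 → ℝ) (x : E3) :
    lap f x = ∑ i, fderiv ℝ (fderiv ℝ f) x (b i) (b i) := by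
  have h1 := congrFun (InnerProductSpace.laplacian_eq_iteratedFDeriv_orthonormalBasis f
    (EuclideanSpace.basisFun (Fin 3) ℝ)) x
  have h2 := congrFun (InnerProductSpace.laplacian_eq_iteratedFDeriv_orthonormalBasis f b) x
  rw [h1] at h2
  simp only [EuclideanSpace.basisFun_apply] at h2
  rw [lap, h2]
  simp [iteratedFDeriv_two_apply]

lemma norm_sq_basis (b : OrthonormalBasis (Fin 3) ℝ E3) (x : E3) :
    ‖x‖ ^ 2 = ⟪b 0, x⟫ ^ 2 + ⟪b 1, x⟫ ^ 2 + ⟪b 2, x⟫ ^ 2 := by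
  have := b.sum_sq_norm_inner_right x
  rw [Fin.sum_univ_three] at this
  simpa using this.symm

lemma sum_angDeriv_angDeriv (hf : Hom0 f) (hs : SmoothOff f) (hx : x ≠ 0) :
    ∑ i, angDeriv b i (angDeriv b i f) x = ‖x‖ ^ 2 * lap f x := by
  set B := fderiv ℝ (fderiv ℝ f) x with hB
  have hsym : ∀ v w, B v w = B w v := hs.second_symm hx
  have h0 : ∀ v, B v x = - fderiv ℝ f x v := hf.second_self hs hx
  have h1 := hf.fderiv_self hs hx
  have h00 : B x x = 0 := by rw [h0, h1, neg_zero]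
  simp only [angDeriv_angDeriv hs hx, ← hB, lap_eq_sum b, rotGen_apply, Fin.sum_univ_three,
    norm_sq_basis b]
  obtain ⟨L, hL⟩ : ∃ L, L = fderiv ℝ f x := ⟨_, rfl⟩
  rw [← hL] at h1 ⊢
  rw [basis_sum b x] at h00 h1
  simp only [map_add, map_smul, map_sub, _root_.add_apply,
    _root_.smul_apply, _root_.sub_apply, smul_eq_mul] at h00 h1 ⊢
  simp [inner_sub_right, inner_smul_right, hsym (b 1) (b 0), hsym (b 2) (b 0),
    hsym (b 2) (b 1)] at h00 h1 ⊢
  linear_combination -h00 - 2 * h1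

lemma SmoothOff.sum_angDeriv_angDeriv (hs : SmoothOff f) (b : OrthonormalBasis (Fin 3) ℝ E3) :
    SmoothOff (fun x => ∑ i, _root_.angDeriv b i (_root_.angDeriv b i f) x) :=
  ContDiffOn.sum fun i _ => (hs.angDeriv b i).angDeriv b i

lemma mem_S2_iff : x ∈ S2 ↔ ‖x‖ = 1 := by simp [S2]

lemma ne_zero_of_mem_S2 (hx : x ∈ S2) : x ≠ 0 := by
  rintro rfl
  simp [mem_S2_iff] at hx

lemma Hom0.eq_normalize (hf : Hom0 f) (hx : x ≠ 0) : f x = f (‖x‖⁻¹ • x) :=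
  (hf x _ (by positivity)).symm

lemma normalize_mem_S2 (hx : x ≠ 0) : ‖x‖⁻¹ • x ∈ S2 := by
  rw [mem_S2_iff, norm_smul, norm_inv, norm_norm, inv_mul_cancel₀ (by simpa using hx)]

variable {u : E3 → ℝ} {α : ℝ}

lemma MFE.sum_angDeriv (hu : MFE u α) (b : OrthonormalBasis (Fin 3) ℝ E3) (hx : x ≠ 0) :
    ∑ i, angDeriv b i (angDeriv b i u) x = α - exp (2 * u x) := by
  obtain ⟨hs, h0, he⟩ := hu
  have h1 : Hom0 (fun x => ∑ i, angDeriv b i (angDeriv b i u) x) := by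
    intro x r hr
    simp only [((h0.angDeriv b _).angDeriv b _) x r hr]
  have hn := normalize_mem_S2 hx
  rw [h1.eq_normalize hx, h0.eq_normalize hx, ← he _ hn,
    sum_angDeriv_angDeriv h0 hs (ne_zero_of_mem_S2 hn), mem_S2_iff.1 hn]
  ring

lemma MFE.sum_angDeriv_angDeriv_angDeriv (hu : MFE u α) (b : OrthonormalBasis (Fin 3) ℝ E3)
    (hx : x ≠ 0) (i : Fin 3) :
    ∑ j, angDeriv b j (angDeriv b j (angDeriv b i u)) x =
      - (2 * exp (2 * u x) * angDeriv b i u x) := by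
  rw [_root_.sum_angDeriv_angDeriv_angDeriv hu.1 hx i,
    angDeriv_congr (fun y hy => hu.sum_angDeriv b hy) hx,
    angDeriv_sub (f := fun _ => α) contDiffOn_const (SmoothOff.exp_two_mul hu.1) hx,
    angDeriv_exp_two_mul hu.1 hx]
  simp [angDeriv]
  ring

lemma sum_angDeriv_sq (hf : Hom0 f) (hs : SmoothOff f) (hx : x ∈ S2) :
    ∑ i, angDeriv b i f x ^ 2 = ‖fderiv ℝ f x‖ ^ 2 := by
  have h1 := hf.fderiv_self hs (ne_zero_of_mem_S2 hx)
  have hn := norm_sq_basis b x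
  rw [mem_S2_iff.1 hx] at hn
  have h2 : ‖fderiv ℝ f x‖ ^ 2 = ∑ i, fderiv ℝ f x (b i) ^ 2 := by
    obtain ⟨v, hv⟩ := (InnerProductSpace.toDual ℝ E3).surjective (fderiv ℝ f x)
    rw [← hv, LinearIsometryEquiv.norm_map, norm_sq_basis b, Fin.sum_univ_three]
    simp [real_inner_comm]
  rw [h2]
  simp only [angDeriv, rotGen_apply, Fin.sum_univ_three]
  generalize fderiv ℝ f x = L at h1 ⊢
  rw [basis_sum b x] at h1
  simp only [map_add, map_sub, map_smul, smul_eq_mul, Fin.isValue, zero_add, Fin.reduceAdd]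
    at h1 ⊢
  generalize L (b 0) = d0 at *
  generalize L (b 1) = d1 at *
  generalize L (b 2) = d2 at *
  linear_combination (-(d0 ^ 2 + d1 ^ 2 + d2 ^ 2)) * hn
    - (⟪b 0, x⟫ * d0 + ⟪b 1, x⟫ * d1 + ⟪b 2, x⟫ * d2) * h1

lemma exists_basis_two {z : E3} (hz : z ∈ S2) : ∃ b : OrthonormalBasis (Fin 3) ℝ E3, b 2 = z := by
  have ho : Orthonormal ℝ (({2} : Set (Fin 3)).domRestrict fun _ => z) := by
    constructor
    · intro i
      exact mem_S2_iff.1 hz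
    · intro i j hij
      exact absurd (Subsingleton.elim i j) hij
  obtain ⟨b, hb⟩ := ho.exists_orthonormalBasis_extension_of_card_eq (by simp)
  exact ⟨b, hb 2 rfl⟩

/-- The rotation orbit of `b 2` about the axis `b j`. -/
noncomputable def rotCurve (b : OrthonormalBasis (Fin 3) ℝ E3) (j : Fin 3) (t : ℝ) : E3 :=
  cos t • b 2 + sin t • rotGen b j (b 2)

lemma rotCurve_zero (j : Fin 3) : rotCurve b j 0 = b 2 := by simp [rotCurve]

lemma rotCurve_mem {j : Fin 3} (hj : j ≠ 2) (t : ℝ) : rotCurve b j t ∈ S2 := by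
  rw [mem_S2_iff, ← sq_eq_sq₀ (norm_nonneg _) zero_le_one, norm_sq_basis b]
  have := sin_sq_add_cos_sq t
  fin_cases j
  · simp [rotCurve, rotGen_apply, inner_add_right, inner_smul_right]
  · simp [rotCurve, rotGen_apply, inner_add_right, inner_smul_right]
  · exact absurd rfl hj

lemma hasDerivAt_rotCurve {j : Fin 3} (hj : j ≠ 2) (hf : SmoothOff f) (t : ℝ) :
    HasDerivAt (fun t => f (rotCurve b j t)) (angDeriv b j f (rotCurve b j t)) t := by
  have h1 : HasDerivAt (rotCurve b j) (rotGen b j (rotCurve b j t)) t := by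
    have h2 := ((hasDerivAt_cos t).smul_const (b 2)).add
      ((hasDerivAt_sin t).smul_const (rotGen b j (b 2)))
    refine h2.congr_deriv ?_
    fin_cases j
    · simp [rotCurve, rotGen_apply, inner_add_right, inner_smul_right]
      abel
    · simp [rotCurve, rotGen_apply, inner_add_right, inner_smul_right]
      abel
    · exact absurd rfl hj
  exact ((hf.differentiableAt
    (ne_zero_of_mem_S2 (rotCurve_mem hj t))).hasFDerivAt).comp_hasDerivAt t h1

lemma angDeriv_two_apply_two : angDeriv b 2 f (b 2) = 0 := by
  simp [angDeriv, rotGen_apply]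

/-- The second derivative test at a local maximum. -/
lemma IsLocalMax.deriv_eq_zero_and_second_nonpos {φ φ' : ℝ → ℝ} {d : ℝ} (hm : IsLocalMax φ 0)
    (h1 : ∀ᶠ t in nhds 0, HasDerivAt φ (φ' t) t) (h2 : HasDerivAt φ' d 0) :
    φ' 0 = 0 ∧ d ≤ 0 := by
  have h0 := hm.hasDerivAt_eq_zero h1.self_of_nhds
  refine ⟨h0, ?_⟩
  by_contra! hd
  have he : deriv φ =ᶠ[nhds 0] φ' := h1.mono fun t ht => ht.deriv
  have hdd : deriv (deriv φ) 0 = d := by rw [he.deriv_eq, h2.deriv]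
  have hmin : IsLocalMin φ 0 := isLocalMin_of_deriv_deriv_pos (by rwa [hdd])
    (by rw [h1.self_of_nhds.deriv, h0]) h1.self_of_nhds.continuousAt
  have hc : φ =ᶠ[nhds 0] fun _ => φ 0 := by
    filter_upwards [hm, hmin] with t h3 h4 using le_antisymm h3 h4
  have h5 : deriv φ =ᶠ[nhds 0] fun _ => 0 := by
    filter_upwards [hc.eventuallyEq_nhds] with t ht
    rw [ht.deriv_eq, deriv_const]
  rw [h5.deriv_eq, deriv_const] at hdd
  exact hd.ne hdd

/-- `4 sinh²` of half the difference of `u` and `v`. -/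
noncomputable def coshGap (u v : E3 → ℝ) (x : E3) : ℝ :=
  exp (u x - v x) + exp (-(u x - v x)) - 2

/-- The gradient quantity to which the maximum principle is applied. -/
noncomputable def gapEnergy (u v : E3 → ℝ) (x : E3) : ℝ :=
  exp (-(u x + v x)) * ‖fderiv ℝ (fun y => u y - v y) x‖ ^ 2 + coshGap u v x

lemma coshGap_nonneg (u v : E3 → ℝ) (x : E3) : 0 ≤ coshGap u v x := by
  have h1 : exp (u x - v x) * exp (-(u x - v x)) = 1 := by rw [← exp_add]; simp
  have h2 := exp_pos (u x - v x)
  have h3 := exp_pos (-(u x - v x))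
  rw [coshGap]
  nlinarith [sq_nonneg (exp (u x - v x) - exp (-(u x - v x)))]

lemma coshGap_pos {u v : E3 → ℝ} {x : E3} (h : u x ≠ v x) : 0 < coshGap u v x := by
  have h1 : exp (u x - v x) * exp (-(u x - v x)) = 1 := by rw [← exp_add]; simp
  have h2 := exp_pos (u x - v x)
  have h3 := exp_pos (-(u x - v x))
  refine (coshGap_nonneg u v x).lt_of_ne fun h0 => h ?_
  rw [coshGap] at h0
  have h4 : exp (u x - v x) = 1 := by nlinarith
  rw [exp_eq_one_iff] at h4
  linarith

lemma gapEnergy_eq {v : E3 → ℝ} (hu : MFE u α) (hv : MFE v α) (b : OrthonormalBasis (Fin 3) ℝ E3)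
    (hx : x ∈ S2) :
    gapEnergy u v x = exp (-(u x + v x)) * ∑ i, angDeriv b i (fun y => u y - v y) x ^ 2
      + exp (u x - v x) + exp (-(u x - v x)) - 2 := by
  rw [gapEnergy, sum_angDeriv_sq (hu.2.1.sub hv.2.1) (SmoothOff.sub hu.1 hv.1) hx, coshGap]
  ring

/-- Derivatives of the gap energy along rotation orbits. -/
lemma gapEnergy_derivs {v : E3 → ℝ} (hu : MFE u α) (hv : MFE v α)
    (b : OrthonormalBasis (Fin 3) ℝ E3) :
    ∃ D : Fin 3 → ℝ → ℝ, ∃ DD : Fin 3 → ℝ,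
      (∀ j ≠ 2, ∀ t, HasDerivAt (fun t => gapEnergy u v (rotCurve b j t)) (D j t) t) ∧
      (∀ j ≠ 2, HasDerivAt (D j) (DD j) 0) ∧
      -(2 * (α - 1)) * (gapEnergy u v (b 2) - coshGap u v (b 2)) * gapEnergy u v (b 2) ≤
        gapEnergy u v (b 2) * (DD 0 + DD 1) - (D 0 0 ^ 2 + D 1 0 ^ 2) := by
  set w : E3 → ℝ := fun y => u y - v y with hw
  have hws : SmoothOff w := SmoothOff.sub hu.1 hv.1
  have hus : SmoothOff u := hu.1
  have hvs : SmoothOff v := hv.1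
  have hz : b 2 ∈ S2 := by simp [mem_S2_iff]
  have hz0 := ne_zero_of_mem_S2 hz
  let D : Fin 3 → ℝ → ℝ := fun j t =>
    exp (-(u (rotCurve b j t) + v (rotCurve b j t))) *
        -(angDeriv b j u (rotCurve b j t) + angDeriv b j v (rotCurve b j t)) *
        ((angDeriv b 0 w (rotCurve b j t)) ^ 2 + (angDeriv b 1 w (rotCurve b j t)) ^ 2
          + (angDeriv b 2 w (rotCurve b j t)) ^ 2)
      + exp (-(u (rotCurve b j t) + v (rotCurve b j t))) *
        (2 * (angDeriv b 0 w (rotCurve b j t) * angDeriv b j (angDeriv b 0 w) (rotCurve b j t)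
          + angDeriv b 1 w (rotCurve b j t) * angDeriv b j (angDeriv b 1 w) (rotCurve b j t)
          + angDeriv b 2 w (rotCurve b j t) * angDeriv b j (angDeriv b 2 w) (rotCurve b j t)))
      + angDeriv b j w (rotCurve b j t) *
        (exp (u (rotCurve b j t) - v (rotCurve b j t))
          - exp (-(u (rotCurve b j t) - v (rotCurve b j t))))
  let DD : Fin 3 → ℝ := fun j =>
    exp (-(u (b 2) + v (b 2))) * (angDeriv b j u (b 2) + angDeriv b j v (b 2)) ^ 2 *
        ((angDeriv b 0 w (b 2)) ^ 2 + (angDeriv b 1 w (b 2)) ^ 2 + (angDeriv b 2 w (b 2)) ^ 2)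
      - exp (-(u (b 2) + v (b 2))) *
        (angDeriv b j (angDeriv b j u) (b 2) + angDeriv b j (angDeriv b j v) (b 2)) *
        ((angDeriv b 0 w (b 2)) ^ 2 + (angDeriv b 1 w (b 2)) ^ 2 + (angDeriv b 2 w (b 2)) ^ 2)
      - 2 * exp (-(u (b 2) + v (b 2))) * (angDeriv b j u (b 2) + angDeriv b j v (b 2)) *
        (2 * (angDeriv b 0 w (b 2) * angDeriv b j (angDeriv b 0 w) (b 2)
          + angDeriv b 1 w (b 2) * angDeriv b j (angDeriv b 1 w) (b 2)
          + angDeriv b 2 w (b 2) * angDeriv b j (angDeriv b 2 w) (b 2)))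
      + exp (-(u (b 2) + v (b 2))) *
        (2 * (angDeriv b j (angDeriv b 0 w) (b 2) ^ 2 + angDeriv b j (angDeriv b 1 w) (b 2) ^ 2
          + angDeriv b j (angDeriv b 2 w) (b 2) ^ 2
          + angDeriv b 0 w (b 2) * angDeriv b j (angDeriv b j (angDeriv b 0 w)) (b 2)
          + angDeriv b 1 w (b 2) * angDeriv b j (angDeriv b j (angDeriv b 1 w)) (b 2)
          + angDeriv b 2 w (b 2) * angDeriv b j (angDeriv b j (angDeriv b 2 w)) (b 2)))
      + angDeriv b j (angDeriv b j w) (b 2) *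
        (exp (u (b 2) - v (b 2)) - exp (-(u (b 2) - v (b 2))))
      + angDeriv b j w (b 2) ^ 2 *
        (exp (u (b 2) - v (b 2)) + exp (-(u (b 2) - v (b 2))))
  have hjw : ∀ (j : Fin 3), ∀ x ≠ 0, angDeriv b j w x = angDeriv b j u x - angDeriv b j v x :=
    fun j x hx => angDeriv_sub hus hvs hx
  refine ⟨D, DD, ?_, ?_, ?_⟩
  · intro j hj t
    have hc := rotCurve_mem (b := b) hj t
    have hU := hasDerivAt_rotCurve (b := b) hj hus t
    have hV := hasDerivAt_rotCurve (b := b) hj hvs t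
    have hW := fun i => (hasDerivAt_rotCurve (b := b) hj (hws.angDeriv b i) t)
    have h := (((hU.fun_add hV).fun_neg.exp.fun_mul ((((hW 0).fun_pow 2).fun_add
      ((hW 1).fun_pow 2)).fun_add ((hW 2).fun_pow 2))).fun_add
      (hU.fun_sub hV).exp).fun_add (hU.fun_sub hV).fun_neg.exp
    have h' := h.sub_const 2
    refine (h'.congr_deriv ?_).congr_of_eventuallyEq (Filter.Eventually.of_forall fun t => ?_)
    · simp only [D, hjw _ _ (ne_zero_of_mem_S2 hc)]
      push_cast
      ring
    · simp only [gapEnergy_eq hu hv b (rotCurve_mem hj t), Fin.sum_univ_three, ← hw]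
  · intro j hj
    have hU := hasDerivAt_rotCurve (b := b) hj hus 0
    have hV := hasDerivAt_rotCurve (b := b) hj hvs 0
    have hW0 := hasDerivAt_rotCurve (b := b) hj (hws.angDeriv b j) 0
    have hU1 := hasDerivAt_rotCurve (b := b) hj (hus.angDeriv b j) 0
    have hV1 := hasDerivAt_rotCurve (b := b) hj (hvs.angDeriv b j) 0
    have hW := fun i => (hasDerivAt_rotCurve (b := b) hj (hws.angDeriv b i) 0)
    have hW2 := fun i => (hasDerivAt_rotCurve (b := b) hj ((hws.angDeriv b i).angDeriv b j) 0)
    have hE := (hU.fun_add hV).fun_neg.exp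
    have h := (((hE.fun_mul (hU1.fun_add hV1).fun_neg).fun_mul ((((hW 0).fun_pow 2).fun_add
      ((hW 1).fun_pow 2)).fun_add ((hW 2).fun_pow 2))).fun_add
      (hE.fun_mul (((((hW 0).fun_mul (hW2 0)).fun_add ((hW 1).fun_mul (hW2 1))).fun_add
        ((hW 2).fun_mul (hW2 2))).const_mul 2))).fun_add
      (hW0.fun_mul ((hU.fun_sub hV).exp.fun_sub (hU.fun_sub hV).fun_neg.exp))
    refine h.congr_deriv ?_
    simp only [DD, rotCurve_zero]
    rw [hjw j _ hz0]
    push_cast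
    ring
  · have hU := hu.sum_angDeriv b hz0
    have hV := hv.sum_angDeriv b hz0
    have hU3 := fun i => hu.sum_angDeriv_angDeriv_angDeriv b hz0 i
    have hV3 := fun i => hv.sum_angDeriv_angDeriv_angDeriv b hz0 i
    have e2 : ∀ i, ∀ x ≠ 0, angDeriv b i (angDeriv b i w) x
        = angDeriv b i (angDeriv b i u) x - angDeriv b i (angDeriv b i v) x := fun i x hx => by
      rw [angDeriv_congr (hjw i) hx, angDeriv_sub (hus.angDeriv b i) (hvs.angDeriv b i) hx]
    have e3 : ∀ i j, angDeriv b j (angDeriv b j (angDeriv b i w)) (b 2)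
        = angDeriv b j (angDeriv b j (angDeriv b i u)) (b 2)
          - angDeriv b j (angDeriv b j (angDeriv b i v)) (b 2) := fun i j => by
      rw [angDeriv_congr (fun x hx => (angDeriv_congr (hjw i) hx).trans
        (angDeriv_sub (hus.angDeriv b i) (hvs.angDeriv b i) hx)) hz0,
        angDeriv_sub ((hus.angDeriv b i).angDeriv b j) ((hvs.angDeriv b i).angDeriv b j) hz0]
    have c0 := angDeriv_comm (b := b) hws hz0 0
    have c1 := angDeriv_comm (b := b) hws hz0 1
    have c2 := angDeriv_comm (b := b) hws hz0 2
    have hexp : exp (2 * u (b 2)) = exp (u (b 2) + v (b 2)) * exp (u (b 2) - v (b 2)) := by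
      rw [← exp_add]; ring_nf
    have hexp' : exp (2 * v (b 2)) = exp (u (b 2) + v (b 2)) * exp (-(u (b 2) - v (b 2))) := by
      rw [← exp_add]; ring_nf
    rw [hexp] at hU hU3
    rw [hexp'] at hV hV3
    have hES : exp (-(u (b 2) + v (b 2))) * exp (u (b 2) + v (b 2)) = 1 := by
      rw [← exp_add]; simp
    have hww : exp (u (b 2) - v (b 2)) * exp (-(u (b 2) - v (b 2))) = 1 := by
      rw [← exp_add]; simp
    have hP := gapEnergy_eq hu hv b hz
    have hPn : 0 ≤ gapEnergy u v (b 2) :=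
      add_nonneg (by positivity) (coshGap_nonneg _ _ _)
    have hE0 := exp_pos (-(u (b 2) + v (b 2)))
    rw [← hw] at hP
    have hF := coshGap_nonneg u v (b 2)
    have w0 := hjw 0 (b 2) hz0
    have w1 := hjw 1 (b 2) hz0
    have a0 := e2 0 (b 2) hz0
    have a1 := e2 1 (b 2) hz0
    have k0 := e3 0 0
    have k0' := e3 0 1
    have k1 := e3 1 0
    have k1' := e3 1 1
    have U0 := hU3 0
    have U1 := hU3 1
    have V0 := hV3 0
    have V1 := hV3 1
    simp only [Fin.isValue, Fin.sum_univ_three, angDeriv_two_apply_two,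
      zero_add, Fin.reduceAdd, add_zero] at hU hV U0 U1 V0 V1 c0 c1 c2 hP
    rw [hP]
    simp only [D, DD, rotCurve_zero, angDeriv_two_apply_two, coshGap]
    rw [coshGap] at hF
    clear hU3 hV3 e2 e3 hjw D DD hP hPn
    generalize exp (-(u (b 2) + v (b 2))) = E at *
    generalize exp (u (b 2) + v (b 2)) = G at *
    generalize exp (u (b 2) - v (b 2)) = a at *
    generalize exp (-(u (b 2) - v (b 2))) = c at *
    generalize angDeriv b 0 (angDeriv b 0 (angDeriv b 0 w)) (b 2) = k00 at *
    generalize angDeriv b 1 (angDeriv b 1 (angDeriv b 0 w)) (b 2) = k10 at *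
    generalize angDeriv b 0 (angDeriv b 0 (angDeriv b 1 w)) (b 2) = k01 at *
    generalize angDeriv b 1 (angDeriv b 1 (angDeriv b 1 w)) (b 2) = k11 at *
    generalize angDeriv b 0 (angDeriv b 0 w) (b 2) = h00 at *
    generalize angDeriv b 1 (angDeriv b 0 w) (b 2) = h10 at *
    generalize angDeriv b 0 (angDeriv b 1 w) (b 2) = h01 at *
    generalize angDeriv b 1 (angDeriv b 1 w) (b 2) = h11 at *
    generalize angDeriv b 0 (angDeriv b 2 w) (b 2) = h02 at *
    generalize angDeriv b 1 (angDeriv b 2 w) (b 2) = h12 at *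
    generalize angDeriv b 0 w (b 2) = g0 at *
    generalize angDeriv b 1 w (b 2) = g1 at *
    generalize angDeriv b 0 u (b 2) = u0 at *
    generalize angDeriv b 1 u (b 2) = u1 at *
    generalize angDeriv b 0 v (b 2) = v0 at *
    generalize angDeriv b 1 v (b 2) = v1 at *
    obtain rfl : u0 = g0 + v0 := by linarith
    obtain rfl : u1 = g1 + v1 := by linarith
    obtain rfl : h12 = -g0 := by linarith
    obtain rfl := c0
    obtain rfl := c2
    have hd : a - c = -E * (h00 + h11) := by
      linear_combination (c - a) * hES + E * hU - E * hV + E * a0 + E * a1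
    have K0 : E * (k00 + k10) = -(2 * a * (g0 + v0) - 2 * c * v0) := by
      linear_combination E * k0 + E * k0' + E * U0 - E * V0
        + (-(2 * a * (g0 + v0)) + 2 * c * v0) * hES
    have K1 : E * (k01 + k11) = -(2 * a * (h02 + v1) - 2 * c * v1) := by
      linear_combination E * k1 + E * k1' + E * U1 - E * V1
        + (-(2 * a * (h02 + v1)) + 2 * c * v1) * hES
    generalize angDeriv b 0 (angDeriv b 0 u) (b 2) = U00 at *
    generalize angDeriv b 1 (angDeriv b 1 u) (b 2) = U11 at *
    generalize angDeriv b 0 (angDeriv b 0 v) (b 2) = V00 at *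
    generalize angDeriv b 1 (angDeriv b 1 v) (b 2) = V11 at *
    have hs : E * (U00 + V00 + (U11 + V11)) = 2 * α * E - (a + c) := by
      linear_combination E * hU + E * hV - (a + c) * hES
    obtain ⟨T, hT⟩ : ∃ T, T = (h00 - h11) / 2 - ((g0 + 2 * v0) * g0 - (h02 + 2 * v1) * h02) / 2 :=
      ⟨_, rfl⟩
    obtain ⟨S, hS⟩ : ∃ S, S = h10 - ((g0 + 2 * v0) * h02 + (h02 + 2 * v1) * g0) / 2 := ⟨_, rfl⟩
    have hL : ∀ X0 X1 Y Z P : ℝ, X0 = 2 * E * (T * g0 + S * h02) →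
        X1 = 2 * E * (S * g0 - T * h02) →
        Y + Z = 4 * E * (T ^ 2 + S ^ 2) - 2 * (α - 1) * E * (g0 ^ 2 + h02 ^ 2) →
        P = E * (g0 ^ 2 + h02 ^ 2) + (a + c - 2) →
        -(2 * (α - 1)) * (P - (a + c - 2)) * P ≤ P * (Y + Z) - (X0 ^ 2 + X1 ^ 2) := by
      rintro X0 X1 Y Z P rfl rfl h rfl
      rw [h]
      have : 0 ≤ 4 * E * (T ^ 2 + S ^ 2) * (a + c - 2) := by positivity
      linarith
    refine hL _ _ _ _ _ ?_ ?_ ?_ ?_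
    · rw [hT, hS]
      linear_combination g0 * hd
    · rw [hT, hS]
      linear_combination h02 * hd
    · rw [hT, hS]
      linear_combination (-(g0 ^ 2 + h02 ^ 2)) * hs + 2 * g0 * K0 + 2 * h02 * K1
        + (h00 + h11 - 2 * (g0 * (g0 + 2 * v0) + h02 * (h02 + 2 * v1))) * hd
    · ring

lemma hasDerivAt_cos_add_sin (a d t : ℝ) :
    HasDerivAt (fun t => cos t * a + sin t * d) (cos t * d - sin t * a) t := by
  refine (((hasDerivAt_cos t).mul_const a).fun_add ((hasDerivAt_sin t).mul_const d)).congr_deriv ?_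
  ring

lemma hasDerivAt_cos_sub_sin (a d t : ℝ) :
    HasDerivAt (fun t => cos t * d - sin t * a) (-(cos t * a + sin t * d)) t := by
  refine (((hasDerivAt_cos t).mul_const d).fun_sub ((hasDerivAt_sin t).mul_const a)).congr_deriv ?_
  ring

/-- The second derivative test for `log ρ` plus logarithmic barriers along a great circle. -/
lemma second_deriv_log_barrier {ρ D : ℝ → ℝ} {DD a d a' d' c e ε η δ : ℝ}
    (hρ : ∀ t, HasDerivAt ρ (D t) t) (hD : HasDerivAt D DD 0) (h0 : 0 < ρ 0)
    (ha : 0 < 1 - a ^ 2) (ha' : 0 < 1 - a' ^ 2) (hc : 0 < 1 + δ - c)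
    (hmax : IsLocalMax (fun t => log (ρ t) + (ε - 1) * (log (1 - (cos t * a + sin t * d) ^ 2)
      + log (1 - (cos t * a' + sin t * d') ^ 2)) - η * log (1 + δ - (cos t * c + sin t * e))) 0) :
    (DD * ρ 0 - D 0 ^ 2) / ρ 0 ^ 2
      + (ε - 1) * (-2 * (d ^ 2 - a ^ 2) / (1 - a ^ 2) - 4 * a ^ 2 * d ^ 2 / (1 - a ^ 2) ^ 2
        + (-2 * (d' ^ 2 - a' ^ 2) / (1 - a' ^ 2) - 4 * a' ^ 2 * d' ^ 2 / (1 - a' ^ 2) ^ 2))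
      + η * (-c / (1 + δ - c) + e ^ 2 / (1 + δ - c) ^ 2) ≤ 0 := by
  have hl : ∀ a d t : ℝ, HasDerivAt (fun t => 1 - (cos t * a + sin t * d) ^ 2)
      (-(2 * (cos t * a + sin t * d) * (cos t * d - sin t * a))) t := fun a d t => by
    refine (((hasDerivAt_cos_add_sin a d t).fun_pow 2).const_sub 1).congr_deriv ?_
    push_cast; ring
  have hl' : ∀ a d t : ℝ, HasDerivAt
      (fun t => -(2 * (cos t * a + sin t * d) * (cos t * d - sin t * a)))
      (-(2 * (cos t * d - sin t * a) ^ 2 - 2 * (cos t * a + sin t * d) ^ 2)) t := fun a d t => by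
    refine (((hasDerivAt_cos_add_sin a d t).const_mul 2).fun_mul
      (hasDerivAt_cos_sub_sin a d t)).fun_neg.congr_deriv ?_
    ring
  have hm : ∀ t : ℝ, HasDerivAt (fun t => 1 + δ - (cos t * c + sin t * e))
      (-(cos t * e - sin t * c)) t := fun t => (hasDerivAt_cos_add_sin c e t).const_sub _
  have hm' : ∀ t : ℝ, HasDerivAt (fun t => -(cos t * e - sin t * c))
      (cos t * c + sin t * e) t := fun t => by
    refine (hasDerivAt_cos_sub_sin c e t).fun_neg.congr_deriv ?_
    ring
  have ev : ∀ φ : ℝ → ℝ, ContinuousAt φ 0 → 0 < φ 0 → ∀ᶠ t in nhds 0, φ t ≠ 0 :=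
    fun φ hφ h => (hφ.eventually (lt_mem_nhds h)).mono fun t ht => (ht : 0 < φ t).ne'
  have e1 := ev ρ (hρ 0).continuousAt h0
  have e2 := ev _ (hl a d 0).continuousAt (by simpa using ha)
  have e3 := ev _ (hl a' d' 0).continuousAt (by simpa using ha')
  have e4 := ev _ (hm 0).continuousAt (by simpa using hc)
  have key := hmax.deriv_eq_zero_and_second_nonpos (φ' := fun t => D t / ρ t
      + (ε - 1) * (-(2 * (cos t * a + sin t * d) * (cos t * d - sin t * a))
          / (1 - (cos t * a + sin t * d) ^ 2)
        + -(2 * (cos t * a' + sin t * d') * (cos t * d' - sin t * a'))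
          / (1 - (cos t * a' + sin t * d') ^ 2))
      - η * (-(cos t * e - sin t * c) / (1 + δ - (cos t * c + sin t * e)))) ?_
    ((((hD.fun_div (hρ 0) h0.ne').fun_add
      ((((hl' a d 0).fun_div (hl a d 0) (by simpa using ha.ne')).fun_add
        ((hl' a' d' 0).fun_div (hl a' d' 0) (by simpa using ha'.ne'))).const_mul (ε - 1)))).fun_sub
      (((hm' 0).fun_div (hm 0) (by simpa using hc.ne')).const_mul η))
  · refine le_of_eq_of_le ?_ key.2
    simp only [cos_zero, sin_zero, one_mul, zero_mul, add_zero, sub_zero]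
    generalize hA : 1 - a ^ 2 = A at *
    generalize hA' : 1 - a' ^ 2 = A' at *
    generalize 1 + δ - c = C at *
    field_simp
    ring
  · filter_upwards [e1, e2, e3, e4] with t h1 h2 h3 h4
    exact (((hρ t).log h1).fun_add ((((hl a d t).log h2).fun_add
      ((hl a' d' t).log h3)).const_mul (ε - 1))).fun_sub (((hm t).log h4).const_mul η)

/-- The logarithm of the function to which the maximum principle is applied. -/
noncomputable def barrierLog (P : E3 → ℝ) (p q y : E3) (ε η δ : ℝ) (x : E3) : ℝ :=
  log (P x) + (ε - 1) * (log (1 - ⟪x, p⟫ ^ 2) + log (1 - ⟪x, q⟫ ^ 2)) - η * log (1 + δ - ⟪x, y⟫)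

lemma inner_rotCurve (b : OrthonormalBasis (Fin 3) ℝ E3) (j : Fin 3) (t : ℝ) (p : E3) :
    ⟪rotCurve b j t, p⟫ = cos t * ⟪b 2, p⟫ + sin t * ⟪rotGen b j (b 2), p⟫ := by
  simp [rotCurve, inner_add_left, inner_smul_left]

lemma sum_inner_rotGen_sq (b : OrthonormalBasis (Fin 3) ℝ E3) {p : E3} (hp : p ∈ S2) :
    ⟪rotGen b 0 (b 2), p⟫ ^ 2 + ⟪rotGen b 1 (b 2), p⟫ ^ 2 = 1 - ⟪b 2, p⟫ ^ 2 := by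
  have h := norm_sq_basis b p
  rw [mem_S2_iff.1 hp] at h
  simp [rotGen_apply]
  linarith

lemma inner_le_one_of_mem_S2 {x y : E3} (hx : x ∈ S2) (hy : y ∈ S2) : ⟪x, y⟫ ≤ 1 := by
  have := real_inner_le_norm x y
  rwa [mem_S2_iff.1 hx, mem_S2_iff.1 hy, one_mul] at this

lemma neg_one_le_inner_of_mem_S2 {x y : E3} (hx : x ∈ S2) (hy : y ∈ S2) : -1 ≤ ⟪x, y⟫ := by
  have := neg_le_of_abs_le (abs_real_inner_le_norm x y)
  rwa [mem_S2_iff.1 hx, mem_S2_iff.1 hy, one_mul] at this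

lemma barrierLog_max_ineq {v : E3 → ℝ} (hu : MFE u α) (hv : MFE v α) (hα : α ≤ 3)
    {p q y z : E3} (hp : p ∈ S2) (hq : q ∈ S2) (hy : y ∈ S2) (hz : z ∈ S2) {ε η δ : ℝ}
    (hδ : 0 < δ) (hP : 0 < gapEnergy u v z) (hzp : 0 < 1 - ⟪z, p⟫ ^ 2) (hzq : 0 < 1 - ⟪z, q⟫ ^ 2)
    (hmax : ∀ x ∈ S2, 0 < gapEnergy u v x → 0 < 1 - ⟪x, p⟫ ^ 2 → 0 < 1 - ⟪x, q⟫ ^ 2 →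
      barrierLog (gapEnergy u v) p q y ε η δ x ≤ barrierLog (gapEnergy u v) p q y ε η δ z) :
    4 * (coshGap u v z / gapEnergy u v z)
      + η * (((1 - ⟪z, y⟫) ^ 2 - 2 * ⟪z, y⟫ * δ) / (1 + δ - ⟪z, y⟫) ^ 2) ≤ 4 * ε := by
  obtain ⟨b, rfl⟩ := exists_basis_two hz
  obtain ⟨D, DD, hD, hDD, hineq⟩ := gapEnergy_derivs hu hv b
  have hc : 0 < 1 + δ - ⟪b 2, y⟫ := by linarith [inner_le_one_of_mem_S2 hz hy]
  have key : ∀ j : Fin 3, j ≠ 2 → _ := fun j hj => by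
    refine second_deriv_log_barrier (ε := ε) (η := η) (a := ⟪b 2, p⟫) (a' := ⟪b 2, q⟫)
      (d := ⟪rotGen b j (b 2), p⟫) (d' := ⟪rotGen b j (b 2), q⟫) (c := ⟪b 2, y⟫)
      (e := ⟪rotGen b j (b 2), y⟫) (hD j hj) (hDD j hj) (by rwa [rotCurve_zero]) hzp hzq hc ?_
    have hcont : ContinuousAt (fun t => gapEnergy u v (rotCurve b j t)) 0 :=
      (hD j hj 0).continuousAt
    have e1 : ∀ᶠ t in nhds 0, 0 < gapEnergy u v (rotCurve b j t) :=
      hcont.eventually (lt_mem_nhds (by simpa [rotCurve_zero] using hP))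
    have hin : ∀ p : E3, 0 < 1 - ⟪b 2, p⟫ ^ 2 →
        ∀ᶠ t in nhds (0 : ℝ), 0 < 1 - ⟪rotCurve b j t, p⟫ ^ 2 := fun p hp => by
      simp only [inner_rotCurve]
      exact (((hasDerivAt_cos_add_sin _ _ 0).fun_pow 2).const_sub 1).continuousAt.eventually
        (lt_mem_nhds (by simpa using hp))
    filter_upwards [e1, hin p hzp, hin q hzq] with t h1 h2 h3
    have := hmax _ (rotCurve_mem hj t) h1 h2 h3
    rw [barrierLog, barrierLog] at this
    simpa [inner_rotCurve, rotCurve_zero] using this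
  have k0 := key 0 (by decide)
  have k1 := key 1 (by decide)
  have sp := sum_inner_rotGen_sq b hp
  have sq := sum_inner_rotGen_sq b hq
  have sy := sum_inner_rotGen_sq b hy
  rw [rotCurve_zero] at k0 k1
  have hF := coshGap_nonneg u v (b 2)
  have hPF : coshGap u v (b 2) ≤ gapEnergy u v (b 2) := by
    rw [gapEnergy]
    have : 0 ≤ exp (-(u (b 2) + v (b 2))) * ‖fderiv ℝ (fun y => u y - v y) (b 2)‖ ^ 2 := by
      positivity
    linarith
  generalize ⟪rotGen b 0 (b 2), p⟫ = p0 at *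
  generalize ⟪rotGen b 1 (b 2), p⟫ = p1 at *
  generalize ⟪rotGen b 0 (b 2), q⟫ = q0 at *
  generalize ⟪rotGen b 1 (b 2), q⟫ = q1 at *
  generalize ⟪rotGen b 0 (b 2), y⟫ = y0 at *
  generalize ⟪rotGen b 1 (b 2), y⟫ = y1 at *
  generalize ⟪b 2, p⟫ = P2 at *
  generalize ⟪b 2, q⟫ = Q2 at *
  generalize ⟪b 2, y⟫ = Y2 at *
  generalize gapEnergy u v (b 2) = P at *
  generalize coshGap u v (b 2) = F at *
  have hA : ∀ a d e : ℝ, 0 < 1 - a ^ 2 → d ^ 2 + e ^ 2 = 1 - a ^ 2 →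
      (-2 * (d ^ 2 - a ^ 2) / (1 - a ^ 2) - 4 * a ^ 2 * d ^ 2 / (1 - a ^ 2) ^ 2)
      + (-2 * (e ^ 2 - a ^ 2) / (1 - a ^ 2) - 4 * a ^ 2 * e ^ 2 / (1 - a ^ 2) ^ 2) = -2 := by
    intro a d e h h'
    have : e ^ 2 = 1 - a ^ 2 - d ^ 2 := by linarith
    rw [this]
    field_simp
    ring
  have hB : -Y2 / (1 + δ - Y2) + y0 ^ 2 / (1 + δ - Y2) ^ 2
      + (-Y2 / (1 + δ - Y2) + y1 ^ 2 / (1 + δ - Y2) ^ 2)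
      = ((1 - Y2) ^ 2 - 2 * Y2 * δ) / (1 + δ - Y2) ^ 2 := by
    have : y1 ^ 2 = 1 - Y2 ^ 2 - y0 ^ 2 := by linarith
    rw [this]
    field_simp
    ring
  have hC : -4 * ((P - F) / P) ≤ (DD 0 * P - D 0 0 ^ 2) / P ^ 2
      + (DD 1 * P - D 1 0 ^ 2) / P ^ 2 := by
    rw [← add_div, ← mul_div_assoc, div_le_div_iff₀ hP (by positivity)]
    nlinarith [mul_nonneg (mul_nonneg (sub_nonneg.2 hPF) hP.le) hP.le,
      mul_nonneg (mul_nonneg (mul_nonneg (sub_nonneg.2 hPF) hP.le) hP.le) (sub_nonneg.2 hα),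
      mul_le_mul_of_nonneg_left hineq hP.le]
  have hD' : (P - F) / P = 1 - F / P := by field_simp
  rw [hD'] at hC
  have hap := hA P2 p0 p1 hzp sp
  have haq := hA Q2 q0 q1 hzq sq
  rw [← hB]
  have := congrArg (fun s => (ε - 1) * s) hap
  have := congrArg (fun s => (ε - 1) * s) haq
  linarith

lemma one_sub_inner_sq_nonneg {x p : E3} (hx : x ∈ S2) (hp : p ∈ S2) : 0 ≤ 1 - ⟪x, p⟫ ^ 2 := by
  nlinarith [inner_le_one_of_mem_S2 hx hp, neg_one_le_inner_of_mem_S2 hx hp]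

lemma S2_subset : S2 ⊆ {(0 : E3)}ᶜ := fun _ hx => ne_zero_of_mem_S2 hx

lemma continuousOn_coshGap {v : E3 → ℝ} (hu : SmoothOff u) (hv : SmoothOff v) :
    ContinuousOn (coshGap u v) S2 := by
  have h := (SmoothOff.sub hu hv).continuousOn.mono S2_subset
  exact (h.rexp.add h.neg.rexp).sub continuousOn_const

lemma continuousOn_gapEnergy {v : E3 → ℝ} (hu : SmoothOff u) (hv : SmoothOff v) :
    ContinuousOn (gapEnergy u v) S2 := by
  have h := (SmoothOff.sub hu hv).fderiv.continuousOn.mono S2_subset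
  exact ((((hu.continuousOn.add hv.continuousOn).mono S2_subset).neg.rexp).mul
    (h.norm.pow 2)).add (continuousOn_coshGap hu hv)

lemma isCompact_S2 : IsCompact S2 := isCompact_sphere _ _

lemma coshGap_le_gapEnergy (u v : E3 → ℝ) (x : E3) : coshGap u v x ≤ gapEnergy u v x := by
  rw [gapEnergy]
  have : 0 ≤ exp (-(u x + v x)) * ‖fderiv ℝ (fun y => u y - v y) x‖ ^ 2 := by positivity
  linarith

/-- Two solutions of the mean field equation whose gap energy vanishes to second order at `±p`
and at `±q` coincide. -/
theorem eq_of_gapEnergy_le {v : E3 → ℝ} (hu : MFE u α) (hv : MFE v α) (hα : α ≤ 3)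
    {p q : E3} (hp : p ∈ S2) (hq : q ∈ S2) {C : ℝ}
    (hC : ∀ x ∈ S2, gapEnergy u v x ≤ C * ((1 - ⟪x, p⟫ ^ 2) * (1 - ⟪x, q⟫ ^ 2)))
    {y : E3} (hy : y ∈ S2) : u y = v y := by
  by_contra hne
  have hFy := coshGap_pos hne
  have hPy := hFy.trans_le (coshGap_le_gapEnergy u v y)
  have hgood : ∀ x ∈ S2, 0 < gapEnergy u v x → 0 < C ∧ 0 < 1 - ⟪x, p⟫ ^ 2 ∧
      0 < 1 - ⟪x, q⟫ ^ 2 := by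
    intro x hx hPx
    have h := hPx.trans_le (hC x hx)
    have h1 := one_sub_inner_sq_nonneg hx hp
    have h2 := one_sub_inner_sq_nonneg hx hq
    have h3 : (1 - ⟪x, p⟫ ^ 2) * (1 - ⟪x, q⟫ ^ 2) ≠ 0 := fun h0 => by simp [h0] at h
    refine ⟨pos_of_mul_pos_left h (mul_nonneg h1 h2), h1.lt_of_ne fun h0 => h3 ?_,
      h2.lt_of_ne fun h0 => h3 ?_⟩
    · rw [← h0, zero_mul]
    · rw [← h0, mul_zero]
  have hC0 := (hgood y hy hPy).1
  obtain ⟨κ, hκ, r, hr, hnear⟩ : ∃ κ > 0, ∃ r > 0, ∀ x ∈ S2, 1 - r ≤ ⟪x, y⟫ →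
      κ ≤ coshGap u v x / gapEnergy u v x := by
    have hcont : ContinuousWithinAt (fun x => coshGap u v x / gapEnergy u v x) S2 y :=
      (continuousOn_coshGap hu.1 hv.1 y hy).div (continuousOn_gapEnergy hu.1 hv.1 y hy) hPy.ne'
    have hpos : 0 < coshGap u v y / gapEnergy u v y := div_pos hFy hPy
    have hev := hcont.eventually (lt_mem_nhds (half_lt_self hpos))
    obtain ⟨ρ, hρ, hball⟩ := Metric.eventually_nhds_iff.1 (eventually_nhdsWithin_iff.1 hev)
    refine ⟨_, half_pos hpos, ρ ^ 2 / 4, by positivity, fun x hx hxy => (hball ?_ hx).le⟩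
    rw [dist_eq_norm, ← sq_lt_sq₀ (norm_nonneg _) hρ.le, norm_sub_sq_real, mem_S2_iff.1 hx,
      mem_S2_iff.1 hy]
    nlinarith [sq_pos_of_pos hρ]
  set δ := r ^ 2 / 4 with hδ
  have hδ0 : 0 < δ := by positivity
  set η := κ * δ with hη
  have hη0 : 0 < η := by positivity
  set m := (r ^ 2 / 2) / (2 + δ) ^ 2 with hm
  have hm0 : 0 < m := by positivity
  set ε := min (1 / 2) (min (κ / 4) (η * m / 8)) with hε
  have hε0 : 0 < ε := by positivity
  have hε1 : ε ≤ 1 / 2 := min_le_left _ _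
  have hε2 : ε ≤ κ / 4 := (min_le_right _ _).trans (min_le_left _ _)
  have hε3 : ε ≤ η * m / 8 := (min_le_right _ _).trans (min_le_right _ _)
  set L := barrierLog (gapEnergy u v) p q y ε η δ with hL
  have hLle : ∀ x ∈ S2, 0 < gapEnergy u v x →
      L x ≤ ε * log (gapEnergy u v x) - (ε - 1) * log C - η * log δ := by
    intro x hx hPx
    obtain ⟨-, h1, h2⟩ := hgood x hx hPx
    have h3 := log_le_log hPx (hC x hx)
    rw [log_mul hC0.ne' (mul_pos h1 h2).ne', log_mul h1.ne' h2.ne'] at h3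
    have h4 : log δ ≤ log (1 + δ - ⟪x, y⟫) :=
      log_le_log hδ0 (by linarith [inner_le_one_of_mem_S2 hx hy])
    rw [hL, barrierLog]
    nlinarith
  set p0 := exp ((L y + (ε - 1) * log C + η * log δ) / ε) with hp0
  have hp0' : 0 < p0 := exp_pos _
  have hsmall : ∀ x ∈ S2, 0 < gapEnergy u v x → gapEnergy u v x < p0 → L x < L y := by
    intro x hx hPx hlt
    have h1 := (log_lt_log hPx hlt)
    rw [hp0, log_exp, lt_div_iff₀ hε0] at h1
    linarith [hLle x hx hPx]
  have hyK : p0 ≤ gapEnergy u v y := by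
    by_contra! h
    exact (hsmall y hy hPy h).false
  have hK : IsCompact (S2 ∩ gapEnergy u v ⁻¹' Set.Ici p0) :=
    isCompact_S2.of_isClosed_subset
      ((continuousOn_gapEnergy hu.1 hv.1).preimage_isClosed_of_isClosed
        isCompact_S2.isClosed isClosed_Ici) Set.inter_subset_left
  have hLc : ContinuousOn L (S2 ∩ gapEnergy u v ⁻¹' Set.Ici p0) := by
    have hin : ∀ p : E3, Continuous fun x : E3 => 1 - ⟪x, p⟫ ^ 2 := fun p => by fun_prop
    have hP : ∀ x ∈ S2 ∩ gapEnergy u v ⁻¹' Set.Ici p0, 0 < gapEnergy u v x :=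
      fun x hx => hp0'.trans_le hx.2
    refine (((((continuousOn_gapEnergy hu.1 hv.1).mono Set.inter_subset_left).log
      fun x hx => (hP x hx).ne').add (continuousOn_const.mul
        (((hin p).continuousOn.log fun x hx => (hgood x hx.1 (hP x hx)).2.1.ne').add
          ((hin q).continuousOn.log fun x hx => (hgood x hx.1 (hP x hx)).2.2.ne')))).sub
            (continuousOn_const.mul (ContinuousOn.log (by fun_prop) fun x hx => ?_)))
    have := inner_le_one_of_mem_S2 hx.1 hy
    exact (show 0 < 1 + δ - ⟪x, y⟫ by linarith).ne'
  obtain ⟨z, ⟨hz, hzK⟩, hzmax⟩ := hK.exists_isMaxOn ⟨y, hy, hyK⟩ hLc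
  have hPz : 0 < gapEnergy u v z := hp0'.trans_le hzK
  have hmax := barrierLog_max_ineq hu hv hα hp hq hy hz hδ0 hPz (hgood z hz hPz).2.1
    (hgood z hz hPz).2.2 (ε := ε) (η := η) fun x hx hPx _ _ => by
      by_cases h : p0 ≤ gapEnergy u v x
      · exact hzmax ⟨hx, h⟩
      · exact (hsmall x hx hPx (not_le.1 h)).le.trans (hzmax ⟨hy, hyK⟩)
  have hc1 := inner_le_one_of_mem_S2 hz hy
  have hc2 := neg_one_le_inner_of_mem_S2 hz hy
  have hrat : 0 ≤ coshGap u v z / gapEnergy u v z := div_nonneg (coshGap_nonneg _ _ _) hPz.le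
  by_cases hzr : 1 - r ≤ ⟪z, y⟫
  · have h1 := hnear z hz hzr
    have h2 : -(2 / δ) ≤ ((1 - ⟪z, y⟫) ^ 2 - 2 * ⟪z, y⟫ * δ) / (1 + δ - ⟪z, y⟫) ^ 2 := by
      have : 0 < 1 + δ - ⟪z, y⟫ := by linarith
      rw [← neg_div, div_le_div_iff₀ hδ0 (by positivity)]
      nlinarith [mul_nonneg (sub_nonneg.2 hc1) hδ0.le, sq_nonneg (1 - ⟪z, y⟫), mul_nonneg (sq_nonneg (1 - ⟪z, y⟫)) hδ0.le, mul_nonneg (mul_nonneg (sub_nonneg.2 hc1) hδ0.le) hδ0.le]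
    have h3 := mul_le_mul_of_nonneg_left h2 hη0.le
    have h4 : η * -(2 / δ) = -(2 * κ) := by
      rw [hη]
      field_simp
    linarith
  · have h2 : m ≤ ((1 - ⟪z, y⟫) ^ 2 - 2 * ⟪z, y⟫ * δ) / (1 + δ - ⟪z, y⟫) ^ 2 := by
      have : 0 < 1 + δ - ⟪z, y⟫ := by linarith
      rw [hm]
      apply div_le_div₀
      · nlinarith
      · nlinarith
      · positivity
      · exact pow_le_pow_left₀ this.le (by linarith) 2
    have h3 := mul_le_mul_of_nonneg_left h2 hη0.le
    nlinarith [mul_pos hη0 hm0]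

lemma fderiv_comp_isometry (f : E3 → ℝ) (A : E3 ≃ₗᵢ[ℝ] E3) (x v : E3) :
    fderiv ℝ (fun y => f (A y)) x v = fderiv ℝ f (A x) (A v) := by
  have h := A.toContinuousLinearEquiv.comp_right_fderiv (f := f) (x := x)
  exact congrArg (fun L : E3 →L[ℝ] ℝ => L v) h

lemma SmoothOff.second_comp_isometry (hf : SmoothOff f) (A : E3 ≃ₗᵢ[ℝ] E3) (hx : x ≠ 0)
    (v w : E3) :
    _root_.fderiv ℝ (_root_.fderiv ℝ fun y => f (A y)) x v w =
      _root_.fderiv ℝ (_root_.fderiv ℝ f) (A x) (A v) (A w) := by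
  have hA : A x ≠ 0 := by simpa using hx
  have h1 : HasFDerivAt (fun y => _root_.fderiv ℝ (fun y => f (A y)) y w)
      (((_root_.fderiv ℝ (_root_.fderiv ℝ f) (A x)).comp
        (A.toContinuousLinearEquiv : E3 →L[ℝ] E3)).flip (A w)) x := by
    have h := (((hf.differentiableAt_fderiv hA).hasFDerivAt).comp x
      A.toContinuousLinearEquiv.hasFDerivAt).clm_apply (hasFDerivAt_const (A w) x)
    simp only [fderiv_comp_isometry]
    refine h.congr_fderiv ?_
    ext v
    simp
  have h2 := (((hf.comp_isometry A).differentiableAt_fderiv hx).hasFDerivAt).clm_apply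
    (hasFDerivAt_const w x)
  have h3 := congrArg (fun L : E3 →L[ℝ] ℝ => L v) (h2.unique h1)
  simpa using h3

lemma MFE.comp_isometry (hu : MFE u α) (A : E3 ≃ₗᵢ[ℝ] E3) : MFE (fun x => u (A x)) α := by
  refine ⟨SmoothOff.comp_isometry hu.1 A, fun x r hr => ?_, fun x hx => ?_⟩
  · simpa using hu.2.1 (A x) r hr
  · have hA : A x ∈ S2 := by simpa [mem_S2_iff] using hx
    rw [← hu.2.2 (A x) hA, lap_eq_sum (EuclideanSpace.basisFun (Fin 3) ℝ),
      lap_eq_sum ((EuclideanSpace.basisFun (Fin 3) ℝ).map A)]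
    simp only [SmoothOff.second_comp_isometry hu.1 A (ne_zero_of_mem_S2 hx),
      OrthonormalBasis.map_apply]

lemma neg_mem_S2 (hx : x ∈ S2) : -x ∈ S2 := by simpa [mem_S2_iff] using hx

lemma fderiv_neg_of_even (he : ∀ x, f (-x) = f x) (x v : E3) :
    fderiv ℝ f (-x) v = -fderiv ℝ f x v := by
  have h := fderiv_comp_isometry f (LinearIsometryEquiv.neg ℝ) x v
  simp [he] at h
  linarith

lemma SmoothOff.second_neg_of_even (hf : SmoothOff f) (he : ∀ x, f (-x) = f x) (hx : x ≠ 0)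
    (v w : E3) :
    _root_.fderiv ℝ (_root_.fderiv ℝ f) (-x) v w = _root_.fderiv ℝ (_root_.fderiv ℝ f) x v w := by
  have h := hf.second_comp_isometry (LinearIsometryEquiv.neg ℝ) hx v w
  simp [he] at h
  exact h.symm

/-- The reflection `Refl y` as a linear isometry, for a unit vector `y`. -/
noncomputable def reflIso (y : E3) : E3 ≃ₗᵢ[ℝ] E3 := (ℝ ∙ y)ᗮ.reflection

lemma reflIso_apply {y : E3} (hy : y ∈ S2) (x : E3) : reflIso y x = Refl y x := by
  rw [reflIso, Submodule.reflection_orthogonal_apply, Submodule.reflection_singleton_apply, Refl,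
    mem_S2_iff.1 hy, real_inner_comm]
  simp only [RCLike.ofReal_real_eq_id, id, one_pow, div_one]
  module

lemma reflIso_of_inner_eq_zero {y : E3} (hy : y ∈ S2) (h : ⟪x, y⟫ = 0) : reflIso y x = x := by
  simp [reflIso_apply hy, Refl, h]

/-- The part of `u` that is odd under the reflection in `y`. -/
noncomputable def reflDiff (y : E3) (u : E3 → ℝ) (x : E3) : ℝ := u x - u (reflIso y x)

lemma SmoothOff.reflDiff (hu : SmoothOff u) (y : E3) : SmoothOff (reflDiff y u) :=
  hu.sub (hu.comp_isometry _)

lemma fderiv_reflDiff (hu : SmoothOff u) {y z : E3} (hy : y ∈ S2) (hz : z ≠ 0) (h : ⟪z, y⟫ = 0)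
    (v : E3) : fderiv ℝ (reflDiff y u) z v = 2 * ⟪v, y⟫ * fderiv ℝ u z y := by
  have h1 : fderiv ℝ (reflDiff y u) z v =
      fderiv ℝ u z v - fderiv ℝ (fun x => u (reflIso y x)) z v := by
    have := fderiv_fun_sub (hu.differentiableAt hz)
      ((hu.comp_isometry (reflIso y)).differentiableAt hz)
    exact congrArg (fun L : E3 →L[ℝ] ℝ => L v) this
  rw [h1, fderiv_comp_isometry, reflIso_of_inner_eq_zero hy h, reflIso_apply hy, Refl, map_sub,
    map_smul, smul_eq_mul]
  ring

lemma second_reflDiff (hu : SmoothOff u) {y z : E3} (hy : y ∈ S2) (hz : z ≠ 0) (h : ⟪z, y⟫ = 0)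
    (v w : E3) : fderiv ℝ (fderiv ℝ (reflDiff y u)) z v w =
      fderiv ℝ (fderiv ℝ u) z v w - fderiv ℝ (fderiv ℝ u) z (reflIso y v) (reflIso y w) := by
  have h0 : fderiv ℝ (reflDiff y u) =ᶠ[nhds z]
      fun x => fderiv ℝ u x - fderiv ℝ (fun x => u (reflIso y x)) x := by
    filter_upwards [isOpen_compl_singleton.mem_nhds hz] with x hx
    exact fderiv_fun_sub (hu.differentiableAt hx)
      ((hu.comp_isometry (reflIso y)).differentiableAt hx)
  rw [h0.fderiv_eq, fderiv_fun_sub (hu.differentiableAt_fderiv hz)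
      ((hu.comp_isometry (reflIso y)).differentiableAt_fderiv hz)]
  have := hu.second_comp_isometry (reflIso y) hz v w
  rw [reflIso_of_inner_eq_zero hy h] at this
  rw [← this]
  rfl

open Asymptotics Topology in
lemma isBigO_pow_succ_of_fderiv {F : Type*} [NormedAddCommGroup F] [NormedSpace ℝ F] {f : E3 → F}
    {z : E3} {k : ℕ} (hd : ∀ᶠ x in 𝓝 z, DifferentiableAt ℝ f x) (h0 : f z = 0)
    (hk : fderiv ℝ f =O[𝓝 z] fun x => ‖x - z‖ ^ k) : f =O[𝓝 z] fun x => ‖x - z‖ ^ (k + 1) := by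
  obtain ⟨C, hC⟩ := hk.bound
  obtain ⟨r, hr, hball⟩ := Metric.eventually_nhds_iff_ball.1 (hd.and hC)
  refine IsBigO.of_bound C ?_
  filter_upwards [Metric.ball_mem_nhds z hr] with x hx
  have hsub : Metric.closedBall z ‖x - z‖ ⊆ Metric.ball z r :=
    Metric.closedBall_subset_ball (by simpa [dist_eq_norm] using hx)
  have h := (convex_closedBall z ‖x - z‖).norm_image_sub_le_of_norm_fderiv_le (f := f)
    (C := C * ‖x - z‖ ^ k) (fun y hy => (hball y (hsub hy)).1) (fun y hy => by
      have h1 := (hball y (hsub hy)).2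
      have h2 : ‖y - z‖ ≤ ‖x - z‖ := by simpa [dist_eq_norm] using hy
      have hC0 : 0 ≤ C ∨ y = z ∧ k ≠ 0 := by
        by_contra! hcon
        obtain ⟨hc, hy2⟩ := hcon
        have hpos : 0 < ‖‖y - z‖ ^ k‖ := by
          by_cases hyz : y = z
          · simp [hy2 hyz]
          · exact norm_pos_iff.2 (pow_ne_zero _ (norm_ne_zero_iff.2 (sub_ne_zero.2 hyz)))
        nlinarith [norm_nonneg (fderiv ℝ f y)]
      rcases hC0 with hC0 | ⟨rfl, hk0⟩
      · refine h1.trans ?_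
        rw [norm_pow, norm_norm]
        gcongr
      · have h3 : ‖fderiv ℝ f y‖ ≤ 0 := by simpa [hk0] using h1
        have h4 := (hball x hx).2
        refine h3.trans ?_
        have := (norm_nonneg _).trans h4
        rwa [norm_pow, norm_norm] at this)
    (Metric.mem_closedBall_self (norm_nonneg _)) (by simp [dist_eq_norm] : x ∈ _)
  rw [h0, sub_zero] at h
  rw [norm_pow, norm_norm, pow_succ, ← mul_assoc]
  exact h

open Asymptotics Topology in
lemma isBigO_gapEnergy {v : E3 → ℝ} (hu : SmoothOff u) (hv : SmoothOff v) {z : E3} (hz : z ≠ 0)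
    {k : ℕ} (h0 : u z = v z)
    (hk : fderiv ℝ (fun x => u x - v x) =O[𝓝 z] fun x => ‖x - z‖ ^ k) :
    gapEnergy u v =O[𝓝 z] fun x => ‖x - z‖ ^ (2 * k) := by
  have hw := hu.sub hv
  have hw1 : (fun x => u x - v x) =O[𝓝 z] fun x => ‖x - z‖ ^ k := by
    have h1 := isBigO_pow_succ_of_fderiv (f := fun x => u x - v x) (z := z) (k := k)
      (by filter_upwards [isOpen_compl_singleton.mem_nhds hz] with x hx
          exact hw.differentiableAt hx) (by simp [h0]) hk
    refine h1.trans ?_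
    have h2 : (fun x : E3 => ‖x - z‖) =O[𝓝 z] fun _ => (1 : ℝ) := by
      refine Filter.Tendsto.isBigO_one (c := ‖z - z‖) ℝ ?_
      exact (continuous_id.sub continuous_const).norm.tendsto z
    simpa [pow_succ] using (isBigO_refl (fun x : E3 => ‖x - z‖ ^ k) (𝓝 z)).mul h2
  have hpow : ∀ x : E3, ‖x - z‖ ^ (2 * k) = (‖x - z‖ ^ k) ^ 2 := fun x => by ring
  simp only [hpow]
  have hcont : ∀ {φ : E3 → ℝ}, ContinuousAt φ z → φ =O[𝓝 z] fun _ => (1 : ℝ) :=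
    fun h => Filter.Tendsto.isBigO_one ℝ h
  have hcu := (hu.differentiableAt hz).continuousAt
  have hcv := (hv.differentiableAt hz).continuousAt
  refine IsBigO.add ?_ ?_
  · have h1 := (hcont (φ := fun x => exp (-(u x + v x))) (hcu.add hcv).neg.rexp).mul
      (hk.norm_left.pow 2)
    simpa using h1
  · have h1 : (fun x => exp ((u x - v x) / 2) - exp (-(u x - v x) / 2)) =O[𝓝 z]
        fun x => ‖x - z‖ ^ k := by
      have hg : (fun t : ℝ => exp (t / 2) - exp (-t / 2)) =O[𝓝 0] fun t => t := by
        have : HasDerivAt (fun t : ℝ => exp (t / 2) - exp (-t / 2))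
            (exp (0 / 2) * (1 / 2) - exp (-0 / 2) * (-1 / 2)) 0 :=
          ((hasDerivAt_id 0).div_const 2).exp.sub ((hasDerivAt_id 0).neg.div_const 2).exp
        simpa using this.isBigO_sub
      have ht : Filter.Tendsto (fun x => u x - v x) (𝓝 z) (𝓝 0) := by
        have h := (hcu.sub hcv).tendsto
        rw [Pi.sub_apply, h0, sub_self] at h
        exact h
      exact (hg.comp_tendsto ht).trans hw1
    refine (h1.pow 2).congr_left fun x => ?_
    rw [coshGap, sub_sq, ← exp_nat_mul, ← exp_nat_mul, mul_assoc, ← exp_add]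
    rw [show (u x - v x) / 2 + -(u x - v x) / 2 = 0 by ring, exp_zero]
    push_cast
    rw [show 2 * ((u x - v x) / 2) = u x - v x by ring,
      show 2 * (-(u x - v x) / 2) = -(u x - v x) by ring]
    ring

/-- A function vanishing to first order when `1 - ⟪x, p⟫ ^ 2` vanishes to second order. -/
lemma one_sub_inner_sq_eq {x p : E3} (hx : x ∈ S2) (hp : p ∈ S2) :
    4 * (1 - ⟪x, p⟫ ^ 2) = ‖x - p‖ ^ 2 * ‖x + p‖ ^ 2 := by
  rw [norm_sub_sq_real, norm_add_sq_real, mem_S2_iff.1 hx, mem_S2_iff.1 hp]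
  ring

open Asymptotics Topology in
lemma isBigO_axisWeight (p z : E3) {k : ℕ} (hk : (z = p ∨ z = -p) → k = 1)
    (hk0 : ¬ (z = p ∨ z = -p) → k = 0) (hp : p ≠ 0) :
    (fun x : E3 => ‖x - z‖ ^ (2 * k)) =O[𝓝 z] fun x => ‖x - p‖ ^ 2 * ‖x + p‖ ^ 2 := by
  have hone : ∀ q : E3, z ≠ q → (fun _ : E3 => (1 : ℝ)) =O[𝓝 z] fun x => ‖x - q‖ ^ 2 := by
    intro q hq
    have hc : Filter.Tendsto (fun x : E3 => ‖x - q‖ ^ 2) (𝓝 z) (𝓝 (‖z - q‖ ^ 2)) :=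
      ((continuous_id.sub continuous_const).norm.pow 2).tendsto z
    have hpos : 0 < ‖z - q‖ ^ 2 := by
      have := norm_pos_iff.2 (sub_ne_zero.2 hq)
      positivity
    refine IsBigO.of_bound (2 / ‖z - q‖ ^ 2) ?_
    filter_upwards [hc.eventually (lt_mem_nhds (half_lt_self hpos))] with x hx
    rw [norm_one, norm_pow, norm_norm, div_mul_eq_mul_div, le_div_iff₀ hpos]
    linarith
  have hpp : p ≠ -p := by
    intro h
    have h2 : (2 : ℝ) • p = 0 := by
      rw [two_smul]
      nth_rewrite 1 [h]
      exact neg_add_cancel p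
    exact hp ((smul_eq_zero.1 h2).resolve_left two_ne_zero)
  by_cases h1 : z = p
  · subst h1
    rw [hk (Or.inl rfl)]
    have := (isBigO_refl (fun x : E3 => ‖x - z‖ ^ 2) (𝓝 z)).mul (hone (-z) hpp)
    simpa using this
  · by_cases h2 : z = -p
    · subst h2
      rw [hk (Or.inr rfl)]
      have := (hone p h1).mul (isBigO_refl (fun x : E3 => ‖x + p‖ ^ 2) (𝓝 (-p)))
      simpa using this
    · rw [hk0 (by tauto)]
      have := (hone p h1).mul (hone (-p) h2)
      simpa using this

open Asymptotics Topology in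
lemma exists_le_of_isBigO {φ ψ : E3 → ℝ} (hψ : ∀ x ∈ S2, 0 ≤ ψ x)
    (h : ∀ z ∈ S2, φ =O[𝓝 z] ψ) : ∃ C, ∀ x ∈ S2, φ x ≤ C * ψ x := by
  suffices ∃ C, ∀ x ∈ S2, x ∈ S2 → φ x ≤ C * ψ x by
    obtain ⟨C, hC⟩ := this
    exact ⟨C, fun x hx => hC x hx hx⟩
  refine isCompact_S2.induction_on (p := fun s => ∃ C, ∀ x ∈ s, x ∈ S2 → φ x ≤ C * ψ x)
    ⟨0, by simp⟩ (fun s t hst ⟨C, hC⟩ => ⟨C, fun x hx => hC x (hst hx)⟩)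
    (fun s t ⟨C, hC⟩ ⟨D, hD⟩ => ⟨max C D, fun x hx hxS => ?_⟩) (fun z hz => ?_)
  · rcases hx with hx | hx
    · exact (hC x hx hxS).trans (mul_le_mul_of_nonneg_right (le_max_left _ _) (hψ x hxS))
    · exact (hD x hx hxS).trans (mul_le_mul_of_nonneg_right (le_max_right _ _) (hψ x hxS))
  · obtain ⟨C, hC⟩ := (h z hz).bound
    refine ⟨{x | ‖φ x‖ ≤ C * ‖ψ x‖}, mem_nhdsWithin_of_mem_nhds hC, C, fun x hx hxS => ?_⟩
    have h1 : ‖φ x‖ ≤ C * ‖ψ x‖ := hx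
    rw [Real.norm_eq_abs (ψ x), abs_of_nonneg (hψ x hxS)] at h1
    exact (le_abs_self _).trans h1

section

open Asymptotics Topology

lemma isBigO_gapEnergy_one {v : E3 → ℝ} (hu : SmoothOff u) (hv : SmoothOff v) {z : E3}
    (hz : z ≠ 0) : gapEnergy u v =O[𝓝 z] fun _ => (1 : ℝ) := by
  have hcu := (hu.differentiableAt hz).continuousAt
  have hcv := (hv.differentiableAt hz).continuousAt
  have h := ((hu.sub hv).differentiableAt_fderiv hz).continuousAt
  have h2 : ContinuousAt (gapEnergy u v) z :=
    ((hcu.add hcv).neg.rexp.mul (h.norm.pow 2)).add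
      (((hcu.sub hcv).rexp.add (hcu.sub hcv).neg.rexp).sub continuousAt_const)
  exact h2.tendsto.isBigO_one ℝ

lemma isBigO_fderiv_of_eq_zero (hf : SmoothOff f) {z : E3} (hz : z ≠ 0) (h1 : fderiv ℝ f z = 0) :
    fderiv ℝ f =O[𝓝 z] fun x => ‖x - z‖ ^ 1 := by
  have := (hf.differentiableAt_fderiv hz).hasFDerivAt.isBigO_sub
  simpa [h1] using this.norm_right

lemma isBigO_fderiv_of_second_eq_zero (hf : SmoothOff f) {z : E3} (hz : z ≠ 0)
    (h1 : fderiv ℝ f z = 0) (h2 : fderiv ℝ (fderiv ℝ f) z = 0) :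
    fderiv ℝ f =O[𝓝 z] fun x => ‖x - z‖ ^ 2 := by
  refine isBigO_pow_succ_of_fderiv ?_ h1 ?_
  · filter_upwards [isOpen_compl_singleton.mem_nhds hz] with x hx
    exact hf.differentiableAt_fderiv hx
  · have h : ContDiffOn ℝ ∞ (fderiv ℝ (fderiv ℝ f)) {(0 : E3)}ᶜ :=
      ContDiffOn.fderiv_of_isOpen hf.fderiv isOpen_compl_singleton (by simp)
    have h3 : DifferentiableAt ℝ (fderiv ℝ (fderiv ℝ f)) z :=
      (h.contDiffAt (isOpen_compl_singleton.mem_nhds hz)).differentiableAt (by simp)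
    have := HasFDerivAt.isBigO_sub (𝕜 := ℝ) (E := E3) (F := E3 →L[ℝ] E3 →L[ℝ] ℝ)
      h3.hasFDerivAt
    refine (this.norm_right.congr (fun x => ?_) fun x => (pow_one _).symm)
    rw [h2]
    exact sub_zero (fderiv ℝ (fderiv ℝ f) x)

lemma eq_refl_of_isBigO {p q y : E3} (hu : MFE u α) (hα : α ≤ 3) (hp : p ∈ S2) (hq : q ∈ S2)
    (hy : y ∈ S2)
    (h : ∀ z ∈ S2, gapEnergy u (fun x => u (reflIso y x)) =O[𝓝 z]
      fun x => ‖x - p‖ ^ 2 * ‖x + p‖ ^ 2 * (‖x - q‖ ^ 2 * ‖x + q‖ ^ 2)) (hx : x ∈ S2) :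
    u x = u (Refl y x) := by
  obtain ⟨C, hC⟩ := exists_le_of_isBigO (fun x _ => by positivity) h
  rw [← reflIso_apply hy]
  refine eq_of_gapEnergy_le hu (hu.comp_isometry (reflIso y)) hα hp hq (C := 16 * C)
    (fun x hx => (hC x hx).trans_eq ?_) hx
  rw [← one_sub_inner_sq_eq hx hp, ← one_sub_inner_sq_eq hx hq]
  ring

lemma fderiv_reflDiff_eq_zero (hu : SmoothOff u) {y z : E3} (hy : y ∈ S2) (hz : z ≠ 0)
    (h : ⟪z, y⟫ = 0) (h1 : fderiv ℝ u z y = 0) : fderiv ℝ (reflDiff y u) z = 0 := by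
  ext v
  rw [fderiv_reflDiff hu hy hz h, h1]
  simp

/-- Reflection symmetry from two pairs of antipodal points at which `u` is symmetric to first
order. -/
theorem eq_refl_of_two_axes {p q y : E3} (hu : MFE u α) (he : ∀ x, u (-x) = u x) (hα : α ≤ 3)
    (hp : p ∈ S2) (hq : q ∈ S2) (hy : y ∈ S2) (hpy : ⟪p, y⟫ = 0) (hqy : ⟪q, y⟫ = 0)
    (hpq : q ≠ p) (hpq' : q ≠ -p) (h1 : fderiv ℝ u p y = 0) (h2 : fderiv ℝ u q y = 0)
    (hx : x ∈ S2) : u x = u (Refl y x) := by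
  refine eq_refl_of_isBigO hu hα hp hq hy (fun z hz => ?_) hx
  have hz0 := ne_zero_of_mem_S2 hz
  have hv : SmoothOff fun x => u (reflIso y x) := SmoothOff.comp_isometry hu.1 _
  have hone : ∀ w : E3, ⟪w, y⟫ = 0 → fderiv ℝ u w y = 0 → (z = w ∨ z = -w) →
      gapEnergy u (fun x => u (reflIso y x)) =O[𝓝 z] fun x => ‖x - z‖ ^ (2 * 1) := by
    intro w hwy hw hzw
    have hzy : ⟪z, y⟫ = 0 := by rcases hzw with rfl | rfl <;> simp [hwy]
    have hzd : fderiv ℝ u z y = 0 := by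
      rcases hzw with rfl | rfl
      · exact hw
      · rw [fderiv_neg_of_even he, hw, neg_zero]
    refine isBigO_gapEnergy hu.1 hv hz0 ?_ ?_
    · rw [reflIso_of_inner_eq_zero hy hzy]
    · exact isBigO_fderiv_of_eq_zero (SmoothOff.reflDiff hu.1 y) hz0
        (fderiv_reflDiff_eq_zero hu.1 hy hz0 hzy hzd)
  have hw : ∀ (w : E3), w ∈ S2 → ∀ k, ((z = w ∨ z = -w) → k = 1) →
      (¬ (z = w ∨ z = -w) → k = 0) →
      (fun x : E3 => ‖x - z‖ ^ (2 * k)) =O[𝓝 z] fun x => ‖x - w‖ ^ 2 * ‖x + w‖ ^ 2 :=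
    fun w hwS k hk hk0 => isBigO_axisWeight w z hk hk0 (ne_zero_of_mem_S2 hwS)
  by_cases hzp : z = p ∨ z = -p
  · have hzq : ¬ (z = q ∨ z = -q) := by
      rintro (rfl | rfl)
      · tauto
      · rcases hzp with h | h
        · exact hpq' (by rw [← h, neg_neg])
        · exact hpq (neg_injective h)
    have := (hw p hp 1 (by simp) (by tauto)).mul (hw q hq 0 (by tauto) (by simp))
    exact (hone p hpy h1 hzp).trans (by simpa using this)
  · by_cases hzq : z = q ∨ z = -q
    · have := (hw p hp 0 (by tauto) (by simp)).mul (hw q hq 1 (by simp) (by tauto))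
      exact (hone q hqy h2 hzq).trans (by simpa using this)
    · have := (hw p hp 0 (by tauto) (by simp)).mul (hw q hq 0 (by tauto) (by simp))
      exact (isBigO_gapEnergy_one hu.1 hv hz0).trans (by simpa using this)

lemma second_reflDiff_eq_zero (hu : Hom0 u) (hs : SmoothOff u) {y p : E3} (hy : y ∈ S2)
    (hp : p ∈ S2) (h : ⟪p, y⟫ = 0) (h1 : fderiv ℝ u p = 0)
    (h2 : ∀ v : E3, ⟪v, p⟫ = 0 → ⟪v, y⟫ = 0 → fderiv ℝ (fderiv ℝ u) p v y = 0) :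
    fderiv ℝ (fderiv ℝ (reflDiff y u)) p = 0 := by
  have hp0 := ne_zero_of_mem_S2 hp
  have hpn := mem_S2_iff.1 hp
  have hyn := mem_S2_iff.1 hy
  have hyp : ⟪y, p⟫ = 0 := by rw [real_inner_comm, h]
  have hBp : ∀ v, fderiv ℝ (fderiv ℝ u) p v p = 0 := fun v => by
    rw [hu.second_self hs hp0, h1]; simp
  have hB : ∀ v : E3, ⟪v, y⟫ = 0 → fderiv ℝ (fderiv ℝ u) p v y = 0 := by
    intro v hv
    have h3 := h2 (v - ⟪v, p⟫ • p) (by simp [inner_sub_left, inner_smul_left, hpn])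
      (by simp [inner_sub_left, inner_smul_left, hv, h])
    rw [map_sub, map_smul, sub_apply, smul_apply, hs.second_symm hp0 p y, hBp y] at h3
    simpa using h3
  ext v w
  rw [second_reflDiff hs hy hp0 h, reflIso_apply hy, reflIso_apply hy]
  have hr : ∀ v : E3, fderiv ℝ (fderiv ℝ u) p v y = ⟪v, y⟫ * fderiv ℝ (fderiv ℝ u) p y y := by
    intro v
    have h3 := hB (v - ⟪v, y⟫ • y) (by simp [inner_sub_left, inner_smul_left, hyn])
    rw [map_sub, map_smul, sub_apply, smul_apply, smul_eq_mul] at h3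
    linarith
  simp only [Refl, map_sub, map_smul, sub_apply, smul_apply, smul_eq_mul]
  rw [hs.second_symm hp0 y w, hr v, hr w]
  simp
  ring

/-- Reflection symmetry from a critical point at which `u` is symmetric to second order. -/
theorem eq_refl_of_critical {p y : E3} (hu : MFE u α) (he : ∀ x, u (-x) = u x) (hα : α ≤ 3)
    (hp : p ∈ S2) (hy : y ∈ S2) (hpy : ⟪p, y⟫ = 0) (h1 : fderiv ℝ u p = 0)
    (h2 : ∀ v : E3, ⟪v, p⟫ = 0 → ⟪v, y⟫ = 0 → fderiv ℝ (fderiv ℝ u) p v y = 0)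
    (hx : x ∈ S2) : u x = u (Refl y x) := by
  refine eq_refl_of_isBigO hu hα hp hp hy (fun z hz => ?_) hx
  have hz0 := ne_zero_of_mem_S2 hz
  have hv : SmoothOff fun x => u (reflIso y x) := SmoothOff.comp_isometry hu.1 _
  by_cases hzp : z = p ∨ z = -p
  · have hzy : ⟪z, y⟫ = 0 := by rcases hzp with rfl | rfl <;> simp [hpy]
    have hzd : fderiv ℝ u z = 0 := by
      rcases hzp with rfl | rfl
      · exact h1
      · ext v
        rw [fderiv_neg_of_even he, h1]; simp
    have hz2 : ∀ v : E3, ⟪v, z⟫ = 0 → ⟪v, y⟫ = 0 → fderiv ℝ (fderiv ℝ u) z v y = 0 := by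
      rcases hzp with rfl | rfl
      · exact h2
      · intro v hvz hvy
        rw [SmoothOff.second_neg_of_even hu.1 he (ne_zero_of_mem_S2 hp)]
        exact h2 v (by simpa using hvz) hvy
    have hk := isBigO_gapEnergy hu.1 hv hz0 (k := 2) (by rw [reflIso_of_inner_eq_zero hy hzy])
      (isBigO_fderiv_of_second_eq_zero (SmoothOff.reflDiff hu.1 y) hz0
        (fderiv_reflDiff_eq_zero hu.1 hy hz0 hzy (by rw [hzd]; simp))
        (second_reflDiff_eq_zero hu.2.1 hu.1 hy hz hzy hzd hz2))
    have hw := isBigO_axisWeight p z (k := 1) (by simp) (by tauto) (ne_zero_of_mem_S2 hp)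
    refine hk.trans ?_
    have := hw.mul hw
    simpa [← pow_add] using this
  · have hw := isBigO_axisWeight p z (k := 0) (by tauto) (by simp) (ne_zero_of_mem_S2 hp)
    have := hw.mul hw
    exact (isBigO_gapEnergy_one hu.1 hv hz0).trans (by simpa using this)

lemma axiallySymmetric_of_refl {p : E3}
    (h : ∀ y ∈ S2, ⟪p, y⟫ = 0 → ∀ x ∈ S2, u x = u (Refl y x)) : AxiallySymmetric u p := by
  intro x hx x' hx' hxp
  by_cases hxx : x = x'
  · rw [hxx]
  have hd := sub_ne_zero.2 hxx
  have hn : ‖x - x'‖ ≠ 0 := norm_ne_zero_iff.2 hd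
  have h1 := h _ (normalize_mem_S2 hd) (by
    rw [real_inner_smul_right, inner_sub_right, real_inner_comm, hxp, real_inner_comm]
    simp) x hx
  rw [h1]
  congr 1
  have h2 : 2 * ⟪x, x - x'⟫ = ‖x - x'‖ ^ 2 := by
    rw [norm_sub_sq_real, inner_sub_right, real_inner_self_eq_norm_sq, mem_S2_iff.1 hx,
      mem_S2_iff.1 hx']
    ring
  rw [Refl, real_inner_smul_right, smul_smul, mul_left_comm, h2]
  have : ‖x - x'‖⁻¹ * ‖x - x'‖ ^ 2 * ‖x - x'‖⁻¹ = 1 := by field_simp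
  rw [this]
  simp

end

/-- A smooth radial function supported in a spherical shell. -/
noncomputable def shellBump (x : E3) : ℝ :=
  (⟨1 / 4, 1 / 2, by norm_num, by norm_num⟩ : ContDiffBump (1 : ℝ)) (‖x‖ ^ 2)

lemma contDiff_shellBump : ContDiff ℝ ∞ shellBump :=
  (ContDiffBump.contDiff _).comp (contDiff_norm_sq ℝ)

lemma shellBump_nonneg (x : E3) : 0 ≤ shellBump x := ContDiffBump.nonneg _

lemma shellBump_eq_one (hx : x ∈ S2) : shellBump x = 1 := by
  refine ContDiffBump.one_of_mem_closedBall _ ?_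
  simp [mem_S2_iff.1 hx]

lemma shellBump_eq_zero (hx : 1 / 2 ≤ |‖x‖ ^ 2 - 1|) : shellBump x = 0 :=
  ContDiffBump.zero_of_le_dist _ (by simpa [Real.dist_eq] using hx)

lemma hasCompactSupport_shellBump : HasCompactSupport shellBump := by
  refine HasCompactSupport.intro (isCompact_closedBall (0 : E3) 2) fun x hx => ?_
  have h1 : 2 < ‖x‖ := by simpa using hx
  refine shellBump_eq_zero ?_
  rw [abs_of_nonneg (by nlinarith)]
  nlinarith

lemma shellBump_eventuallyEq_zero : shellBump =ᶠ[nhds 0] 0 := by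
  filter_upwards [Metric.ball_mem_nhds (0 : E3) (ε := 1 / 2) (by norm_num)] with x hx
  have h1 : ‖x‖ < 1 / 2 := by simpa using hx
  refine shellBump_eq_zero ?_
  rw [abs_of_nonpos (by nlinarith [norm_nonneg x])]
  nlinarith [norm_nonneg x]

lemma SmoothOff.contDiff_shellBump_mul (hg : SmoothOff g) :
    ContDiff ℝ ∞ fun x => shellBump x * g x := by
  rw [contDiff_iff_contDiffAt]
  intro x
  by_cases hx : x = 0
  · subst hx
    refine (contDiffAt_const (c := (0 : ℝ))).congr_of_eventuallyEq ?_
    filter_upwards [shellBump_eventuallyEq_zero] with x hx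
    simp [hx]
  · exact contDiff_shellBump.contDiffAt.mul (hg.contDiffAt hx)

lemma hasCompactSupport_shellBump_mul (g : E3 → ℝ) :
    HasCompactSupport fun x => shellBump x * g x :=
  hasCompactSupport_shellBump.mul_right

lemma inner_rotGen_self (b : OrthonormalBasis (Fin 3) ℝ E3) (i : Fin 3) (x : E3) :
    ⟪x, rotGen b i x⟫ = 0 := by
  rw [rotGen_apply, inner_sub_right, real_inner_smul_right, real_inner_smul_right,
    real_inner_comm x, real_inner_comm x]
  ring

lemma fderiv_shellBump_rotGen (b : OrthonormalBasis (Fin 3) ℝ E3) (i : Fin 3) (x : E3) :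
    fderiv ℝ shellBump x (rotGen b i x) = 0 := by
  set φ : ContDiffBump (1 : ℝ) := ⟨1 / 4, 1 / 2, by norm_num, by norm_num⟩
  have h1 : HasFDerivAt (fun y : E3 => ‖y‖ ^ 2) (2 • innerSL ℝ x) x :=
    (hasStrictFDerivAt_norm_sq x).hasFDerivAt
  have h2 : HasDerivAt φ (deriv φ (‖x‖ ^ 2)) (‖x‖ ^ 2) :=
    ((φ.contDiff (n := 1)).differentiable (by simp)).differentiableAt.hasDerivAt
  have h3 : HasFDerivAt shellBump (deriv φ (‖x‖ ^ 2) • (2 • innerSL ℝ x)) x :=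
    h2.comp_hasFDerivAt x h1
  rw [h3.fderiv]
  simp [inner_rotGen_self]

lemma integral_inner_mul_fderiv {F : E3 → ℝ} (hF : ContDiff ℝ ∞ F) (hc : HasCompactSupport F)
    {v w : E3} (hvw : ⟪v, w⟫ = 0) : ∫ x, ⟪v, x⟫ * fderiv ℝ F x w = 0 := by
  have hlin : ∀ x, fderiv ℝ (fun y => ⟪v, y⟫) x w = 0 := fun x => by
    rw [show (fun y => ⟪v, y⟫) = innerSL ℝ v from rfl, ContinuousLinearMap.fderiv]
    simpa using hvw
  have hcv : Continuous fun x : E3 => ⟪v, x⟫ := by fun_prop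
  have hcf : Continuous fun x => fderiv ℝ F x w :=
    (hF.continuous_fderiv (by simp)).clm_apply continuous_const
  have h := integral_mul_fderiv_eq_neg_fderiv_mul_of_integrable (μ := (volume : Measure E3))
    (f := fun y => ⟪v, y⟫) (g := F) (v := w) (by simp [hlin])
    ((hcv.mul hcf).integrable_of_hasCompactSupport
      ((hc.fderiv_apply (𝕜 := ℝ) w).mul_left))
    ((hcv.mul hF.continuous).integrable_of_hasCompactSupport hc.mul_left)
    (fun x _ => (innerSL ℝ v).differentiableAt)
    (fun x _ => (hF.differentiable (by simp)).differentiableAt)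
  rw [h]
  simp [hlin]

lemma integral_shellBump_mul_angDeriv (hg : SmoothOff g) (b : OrthonormalBasis (Fin 3) ℝ E3)
    (i : Fin 3) : ∫ x, shellBump x * angDeriv b i g x = 0 := by
  have hF := hg.contDiff_shellBump_mul
  have hc := hasCompactSupport_shellBump_mul g
  set F := fun x => shellBump x * g x with hFdef
  have h1 : ∀ x, shellBump x * angDeriv b i g x =
      ⟪b (i + 1), x⟫ * fderiv ℝ F x (b (i + 2)) - ⟪b (i + 2), x⟫ * fderiv ℝ F x (b (i + 1)) := by
    intro x
    trans fderiv ℝ F x (rotGen b i x)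
    · by_cases hx : x = 0
      · subst hx
        simp [angDeriv]
      · have := fderiv_fun_mul (contDiff_shellBump.differentiable (by simp)).differentiableAt
          (hg.differentiableAt hx)
        rw [hFdef, this]
        simp [angDeriv, fderiv_shellBump_rotGen]
    · rw [rotGen_apply, map_sub, map_smul, map_smul, smul_eq_mul, smul_eq_mul]
  have hint : ∀ v w : E3, Integrable fun x => ⟪v, x⟫ * fderiv ℝ F x w := fun v w =>
    (((continuous_const.inner continuous_id).mul
      ((hF.continuous_fderiv (by simp)).clm_apply continuous_const))).integrable_of_hasCompactSupport
      ((hc.fderiv_apply (𝕜 := ℝ) w).mul_left)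
  simp only [h1]
  rw [integral_sub (hint _ _) (hint _ _), integral_inner_mul_fderiv hF hc,
    integral_inner_mul_fderiv hF hc, sub_zero]
  all_goals
    rw [inner_basis]
    simp

lemma SmoothOff.mul (hf : SmoothOff f) (hg : SmoothOff g) : SmoothOff (fun x => f x * g x) :=
  ContDiffOn.mul hf hg

lemma integral_shellBump_wronskian (hf : SmoothOff f) (hg : SmoothOff g)
    (b : OrthonormalBasis (Fin 3) ℝ E3) :
    ∫ x, shellBump x * (f x * (∑ i, angDeriv b i (angDeriv b i g) x) -
      g x * ∑ i, angDeriv b i (angDeriv b i f) x) = 0 := by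
  have hW : ∀ i, SmoothOff fun x => f x * angDeriv b i g x - g x * angDeriv b i f x := fun i =>
    (hf.mul (hg.angDeriv b i)).sub (hg.mul (hf.angDeriv b i))
  have h1 : ∀ x, shellBump x * (f x * (∑ i, angDeriv b i (angDeriv b i g) x) -
      g x * ∑ i, angDeriv b i (angDeriv b i f) x) =
      ∑ i, shellBump x * angDeriv b i (fun x => f x * angDeriv b i g x - g x * angDeriv b i f x) x := by
    intro x
    by_cases hx : x = 0
    · simp [hx, shellBump_eventuallyEq_zero.self_of_nhds]
    · rw [← Finset.mul_sum, Finset.mul_sum, Finset.mul_sum, ← Finset.sum_sub_distrib]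
      congr 1
      refine Finset.sum_congr rfl fun i _ => ?_
      rw [angDeriv_sub (hf.mul (hg.angDeriv b i)) (hg.mul (hf.angDeriv b i)) hx,
        angDeriv_mul hf (hg.angDeriv b i) hx, angDeriv_mul hg (hf.angDeriv b i) hx]
      ring
  simp only [h1]
  rw [integral_finsetSum]
  · simp [integral_shellBump_mul_angDeriv (hW _)]
  · intro i _
    exact (((hW i).angDeriv b i).contDiff_shellBump_mul.continuous).integrable_of_hasCompactSupport
      (hasCompactSupport_shellBump_mul _)

/-- The product of the three angular derivatives of a solution has weighted mean zero. -/
theorem MFE.integral_angDeriv_prod (hu : MFE u α) (b : OrthonormalBasis (Fin 3) ℝ E3) :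
    ∫ x, shellBump x * (exp (2 * u x) * (angDeriv b 0 u x * angDeriv b 1 u x * angDeriv b 2 u x))
      = 0 := by
  have hs : SmoothOff u := hu.1
  have hE := hs.exp_two_mul
  have h0 := hs.angDeriv b 0
  have hf := h0.angDeriv b 1
  have h := integral_shellBump_wronskian (hs.angDeriv b 2) hf b
  have h1 : ∀ x, shellBump x * (angDeriv b 2 u x *
        (∑ i, angDeriv b i (angDeriv b i (angDeriv b 1 (angDeriv b 0 u))) x) -
      angDeriv b 1 (angDeriv b 0 u) x * ∑ i, angDeriv b i (angDeriv b i (angDeriv b 2 u)) x) =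
      -4 * (shellBump x *
        (exp (2 * u x) * (angDeriv b 0 u x * angDeriv b 1 u x * angDeriv b 2 u x))) := by
    intro x
    by_cases hx : x = 0
    · simp [hx, shellBump_eventuallyEq_zero.self_of_nhds]
    have hd : angDeriv b 1 (fun y => ∑ j, angDeriv b j (angDeriv b j (angDeriv b 0 u)) y) x =
        -2 * (exp (2 * u x) * angDeriv b 1 (angDeriv b 0 u) x +
          exp (2 * u x) * (2 * angDeriv b 1 u x) * angDeriv b 0 u x) := by
      rw [angDeriv_congr (f := fun y => ∑ j, angDeriv b j (angDeriv b j (angDeriv b 0 u)) y)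
          (g := fun y => (-2 : ℝ) * (exp (2 * u y) * angDeriv b 0 u y))
          (fun y hy => by rw [hu.sum_angDeriv_angDeriv_angDeriv b hy]; ring) hx,
        angDeriv_mul (f := fun _ => (-2 : ℝ)) contDiffOn_const (hE.mul h0) hx,
        angDeriv_mul hE h0 hx, angDeriv_exp_two_mul hs hx]
      have : angDeriv b 1 (fun _ => (-2 : ℝ)) x = 0 := by simp [angDeriv]
      rw [this]
      ring
    rw [hu.sum_angDeriv_angDeriv_angDeriv b hx, _root_.sum_angDeriv_angDeriv_angDeriv h0 hx, hd]
    ring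
  simp only [h1] at h
  rw [integral_const_mul] at h
  linarith

lemma exists_basis_eq {v : Fin 3 → E3} (hv : Orthonormal ℝ v) :
    ∃ b : OrthonormalBasis (Fin 3) ℝ E3, ∀ i, b i = v i := by
  have ho : Orthonormal ℝ ((Set.univ : Set (Fin 3)).domRestrict v) :=
    hv.comp _ Subtype.val_injective
  obtain ⟨b, hb⟩ := ho.exists_orthonormalBasis_extension_of_card_eq (by simp)
  exact ⟨b, fun i => hb i (Set.mem_univ i)⟩

lemma basis_mem_S2 (b : OrthonormalBasis (Fin 3) ℝ E3) (i : Fin 3) : b i ∈ S2 :=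
  mem_S2_iff.2 (b.orthonormal.1 i)

/-- The Hessian can be diagonalized in an orthonormal basis adapted to a given point. -/
lemma exists_basis_second_eq_zero (hu : SmoothOff u) {p : E3} (hp : p ∈ S2) :
    ∃ b : OrthonormalBasis (Fin 3) ℝ E3, b 2 = p ∧
      fderiv ℝ (fderiv ℝ u) p (b 0) (b 1) = 0 := by
  obtain ⟨c, hc⟩ := exists_basis_two hp
  set φ : ℝ → ℝ := fun t => fderiv ℝ (fderiv ℝ u) p (cos t • c 0 + sin t • c 1)
    (-sin t • c 0 + cos t • c 1)
  have hφ : Continuous φ := by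
    have h : Continuous fun t : ℝ => fderiv ℝ (fderiv ℝ u) p (cos t • c 0 + sin t • c 1) :=
      (fderiv ℝ (fderiv ℝ u) p).continuous.comp (by fun_prop)
    exact h.clm_apply (by fun_prop)
  have h0 : φ 0 = fderiv ℝ (fderiv ℝ u) p (c 0) (c 1) := by simp [φ]
  have h1 : φ (π / 2) = -fderiv ℝ (fderiv ℝ u) p (c 0) (c 1) := by
    simp [φ, hu.second_symm (ne_zero_of_mem_S2 hp) (c 1)]
  obtain ⟨t, ht⟩ : ∃ t, φ t = 0 := by
    rcases le_total (fderiv ℝ (fderiv ℝ u) p (c 0) (c 1)) 0 with h | h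
    · exact mem_range_of_exists_le_of_exists_ge hφ ⟨0, by rw [h0]; exact h⟩
        ⟨π / 2, by rw [h1]; linarith⟩
    · exact mem_range_of_exists_le_of_exists_ge hφ ⟨π / 2, by rw [h1]; linarith⟩
        ⟨0, by rw [h0]; exact h⟩
  have hcs := cos_sq_add_sin_sq t
  have ho : Orthonormal ℝ ![cos t • c 0 + sin t • c 1, -sin t • c 0 + cos t • c 1, c 2] := by
    rw [orthonormal_iff_ite]
    intro i j
    fin_cases i <;> fin_cases j <;>
      simp [inner_add_left, inner_add_right, inner_smul_left, inner_smul_right, inner_basis,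
        -inner_self_eq_norm_sq_to_K] <;>
      nlinarith
  obtain ⟨b, hb⟩ := exists_basis_eq ho
  refine ⟨b, by rw [hb 2, ← hc]; rfl, ?_⟩
  rw [hb 0, hb 1]
  exact ht

lemma Hom0.eq_comp_reflIso (hu : Hom0 u) {y : E3} (hy : y ∈ S2)
    (h : ∀ x ∈ S2, u x = u (Refl y x)) (x : E3) : u (reflIso y x) = u x := by
  by_cases hx : x = 0
  · simp [hx]
  · have h1 := h _ (normalize_mem_S2 hx)
    rw [← reflIso_apply hy, map_smul, hu _ _ (by positivity), hu _ _ (by positivity)] at h1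
    exact h1.symm

lemma reflIso_self {y : E3} (hy : y ∈ S2) : reflIso y y = -y := by
  rw [reflIso_apply hy, Refl, real_inner_self_eq_norm_sq, mem_S2_iff.1 hy]
  module

lemma fderiv_eq_zero_of_reflIso {y z : E3} (hy : y ∈ S2) (h : ∀ x, u (reflIso y x) = u x)
    (hzy : ⟪z, y⟫ = 0) : fderiv ℝ u z y = 0 := by
  have h1 := fderiv_comp_isometry u (reflIso y) z y
  simp only [h, reflIso_of_inner_eq_zero hy hzy, reflIso_self hy, map_neg] at h1
  linarith

lemma second_eq_zero_of_reflIso (hu : SmoothOff u) {y z v : E3} (hy : y ∈ S2)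
    (h : ∀ x, u (reflIso y x) = u x) (hz : z ≠ 0) (hzy : ⟪z, y⟫ = 0) (hvy : ⟪v, y⟫ = 0) :
    fderiv ℝ (fderiv ℝ u) z v y = 0 := by
  have h1 := hu.second_comp_isometry (reflIso y) hz v y
  simp only [h, reflIso_of_inner_eq_zero hy hzy, reflIso_of_inner_eq_zero hy hvy, reflIso_self hy,
    map_neg] at h1
  linarith

lemma fderiv_basis_eq_zero (hu : MFE u α) (hR : ∀ i x, u (reflIso (b i) x) = u x) (i : Fin 3) :
    fderiv ℝ u (b i) = 0 := by
  refine ContinuousLinearMap.coe_injective (b.toBasis.ext fun j => ?_)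
  rw [OrthonormalBasis.coe_toBasis]
  by_cases hij : i = j
  · subst hij
    exact hu.2.1.fderiv_self hu.1 (ne_zero_of_mem_S2 (basis_mem_S2 b i))
  · exact fderiv_eq_zero_of_reflIso (basis_mem_S2 b j) (hR j) (by simp [hij])

lemma inner_eq_zero_basis (i : Fin 3) {v : E3} (hv : ⟪v, b i⟫ = 0) :
    v = ⟪b (i + 1), v⟫ • b (i + 1) + ⟪b (i + 2), v⟫ • b (i + 2) := by
  rw [real_inner_comm] at hv
  have h := basis_sum b v
  fin_cases i
  · have hv' : ⟪b 0, v⟫ = 0 := hv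
    rw [hv'] at h
    simpa using h
  · have hv' : ⟪b 1, v⟫ = 0 := hv
    rw [hv'] at h
    simpa [add_comm] using h
  · have hv' : ⟪b 2, v⟫ = 0 := hv
    rw [hv'] at h
    simpa using h

/-- A solution symmetric in the three coordinate planes, one of whose angular derivatives has a
zero off the corresponding planes, is axially symmetric. -/
theorem axiallySymmetric_of_angDeriv_eq_zero (hu : MFE u α) (he : ∀ x, u (-x) = u x) (hα : α ≤ 3)
    (hR : ∀ i x, u (reflIso (b i) x) = u x) {q : E3} (i : Fin 3) (hj : ⟪b (i + 1), q⟫ ≠ 0)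
    (hk : ⟪b (i + 2), q⟫ ≠ 0) (h0 : angDeriv b i u q = 0) : AxiallySymmetric u (b i) := by
  have hq0 : q ≠ 0 := by
    rintro rfl
    simp at hj
  wlog hq : q ∈ S2 generalizing q
  · have hn : ‖q‖⁻¹ ≠ 0 := by simpa using hq0
    refine this (q := ‖q‖⁻¹ • q) ?_ ?_ ?_ (smul_ne_zero hn hq0) (normalize_mem_S2 hq0)
    · rw [real_inner_smul_right]
      exact mul_ne_zero hn hj
    · rw [real_inner_smul_right]
      exact mul_ne_zero hn hk
    · rwa [hu.2.1.angDeriv b i q _ (by positivity)]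
  have hi := basis_mem_S2 b i
  have hi0 := ne_zero_of_mem_S2 hi
  have n1 : i + 1 ≠ i := by fin_cases i <;> simp
  have n2 : i + 2 ≠ i := by fin_cases i <;> simp
  have n3 : i + 1 ≠ i + 2 := by fin_cases i <;> simp
  set s := ⟪b (i + 1), q⟫ with hs
  set t := ⟪b (i + 2), q⟫ with ht
  have hg : rotGen b i q = s • b (i + 2) - t • b (i + 1) := rotGen_apply b i q
  have hg0 : rotGen b i q ≠ 0 := by
    intro h
    have h1 : ⟪b (i + 2), rotGen b i q⟫ = s := by
      rw [hg]
      simp [inner_sub_right, inner_smul_right, n3.symm]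
    rw [h, inner_zero_right] at h1
    exact hj h1.symm
  have hyS := normalize_mem_S2 hg0
  set y := ‖rotGen b i q‖⁻¹ • rotGen b i q with hy
  have hiy : ⟪b i, y⟫ = 0 := by
    rw [hy, hg]
    simp [inner_sub_right, inner_smul_right, n1.symm, n2.symm]
  have hqy : ⟪q, y⟫ = 0 := by
    rw [hy, real_inner_smul_right, inner_rotGen_self, mul_zero]
  have hne : q ≠ b i := by
    rintro rfl
    exact hj (by rw [hs, inner_basis, if_neg n1])
  have hne' : q ≠ -b i := by
    rintro rfl
    exact hj (by rw [hs, inner_neg_right, inner_basis, if_neg n1, neg_zero])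
  have hcrit := fderiv_basis_eq_zero hu hR i
  have hsym := hu.2.1.eq_comp_reflIso hyS fun x hx =>
    eq_refl_of_two_axes hu he hα hi hq hyS hiy hqy hne hne' (by rw [hcrit]; rfl)
      (by rw [hy, map_smul]; simp [show fderiv ℝ u q (rotGen b i q) = 0 from h0]) hx
  have hB := second_eq_zero_of_reflIso (v := s • b (i + 1) + t • b (i + 2)) hu.1 hyS hsym hi0 hiy (by
    rw [hy, hg]
    simp [inner_sub_right, inner_add_left, inner_smul_left, inner_smul_right, n3,
      n3.symm, mul_comm])
  have hoff : ∀ {j k : Fin 3}, j ≠ i → k ≠ i → j ≠ k →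
      fderiv ℝ (fderiv ℝ u) (b i) (b j) (b k) = 0 := fun {j k} hji hki hjk =>
    second_eq_zero_of_reflIso hu.1 (basis_mem_S2 b k) (hR k) hi0
      (by rw [inner_basis, if_neg hki.symm]) (by rw [inner_basis, if_neg hjk])
  have hoff1 := hoff n1 n2 n3
  have hoff2 := hoff n2 n1 n3.symm
  have humb : fderiv ℝ (fderiv ℝ u) (b i) (b (i + 1)) (b (i + 1)) =
      fderiv ℝ (fderiv ℝ u) (b i) (b (i + 2)) (b (i + 2)) := by
    have hn : ‖rotGen b i q‖ ≠ 0 := norm_ne_zero_iff.2 hg0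
    rw [hy, map_smul, smul_eq_mul, hg] at hB
    have h1 := (mul_eq_zero.1 hB).resolve_left (by simpa [hg] using hn)
    simp only [map_add, map_sub, map_smul, add_apply, smul_apply, smul_eq_mul, hoff1, hoff2] at h1
    have h2 : s * t * (fderiv ℝ (fderiv ℝ u) (b i) (b (i + 2)) (b (i + 2)) -
        fderiv ℝ (fderiv ℝ u) (b i) (b (i + 1)) (b (i + 1))) = 0 := by linarith
    have h3 := (mul_eq_zero.1 h2).resolve_left (mul_ne_zero hj hk)
    linarith
  refine axiallySymmetric_of_refl fun y' hy' hpy' x hx =>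
    eq_refl_of_critical hu he hα hi hy' hpy' hcrit (fun v hv hvy => ?_) hx
  have e1 := inner_eq_zero_basis (b := b) i hv
  have e2 := inner_eq_zero_basis (b := b) i ((real_inner_comm _ _).trans hpy')
  set a1 := ⟪b (i + 1), v⟫
  set a2 := ⟪b (i + 2), v⟫
  set c1 := ⟪b (i + 1), y'⟫
  set c2 := ⟪b (i + 2), y'⟫
  rw [e1, e2] at hvy ⊢
  simp only [map_add, map_smul, add_apply, smul_apply, smul_eq_mul, hoff1, hoff2, humb]
  simp [inner_add_left, inner_add_right, inner_smul_left, inner_smul_right, n3,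
    n3.symm] at hvy
  linear_combination (fderiv ℝ (fderiv ℝ u) (b i) (b (i + 2)) (b (i + 2))) * hvy

lemma rotGen_reflIso (b : OrthonormalBasis (Fin 3) ℝ E3) (i m : Fin 3) (x : E3) :
    rotGen b m (reflIso (b i) x) =
      (if m = i then (1 : ℝ) else -1) • reflIso (b i) (rotGen b m x) := by
  simp only [reflIso_apply (basis_mem_S2 b i), Refl, rotGen_apply]
  fin_cases i <;> fin_cases m <;>
    simp [inner_sub_left, inner_sub_right, inner_smul_left, inner_smul_right,
      real_inner_comm] <;>
    module

lemma angDeriv_reflIso {i : Fin 3} (hR : ∀ x, u (reflIso (b i) x) = u x) (m : Fin 3) (x : E3) :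
    angDeriv b m u (reflIso (b i) x) = (if m = i then (1 : ℝ) else -1) * angDeriv b m u x := by
  rw [angDeriv, rotGen_reflIso, map_smul, smul_eq_mul, ← fderiv_comp_isometry u (reflIso (b i))]
  simp only [hR]
  rfl

/-- The product of the three angular derivatives. -/
noncomputable def angProd (b : OrthonormalBasis (Fin 3) ℝ E3) (u : E3 → ℝ) (x : E3) : ℝ :=
  angDeriv b 0 u x * angDeriv b 1 u x * angDeriv b 2 u x

lemma angProd_reflIso {i : Fin 3} (hR : ∀ x, u (reflIso (b i) x) = u x) (x : E3) :
    angProd b u (reflIso (b i) x) = angProd b u x := by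
  simp only [angProd, angDeriv_reflIso hR]
  fin_cases i <;> simp

lemma inner_reflIso (b : OrthonormalBasis (Fin 3) ℝ E3) (i j : Fin 3) (x : E3) :
    ⟪b j, reflIso (b i) x⟫ = if j = i then -⟪b j, x⟫ else ⟪b j, x⟫ := by
  rw [reflIso_apply (basis_mem_S2 b i), Refl, inner_sub_right, real_inner_smul_right, inner_basis,
    real_inner_comm]
  split_ifs with h
  · subst h; ring
  · ring

lemma exists_abs_inner (hR : ∀ i x, u (reflIso (b i) x) = u x) (x : E3) :
    ∃ x', (∀ j, ⟪b j, x'⟫ = |⟪b j, x⟫|) ∧ angProd b u x' = angProd b u x := by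
  have step : ∀ (i : Fin 3) (x : E3), ∃ x', (∀ j, ⟪b j, x'⟫ = if j = i then |⟪b j, x⟫| else ⟪b j, x⟫) ∧
      angProd b u x' = angProd b u x := by
    intro i x
    rcases le_total 0 ⟪b i, x⟫ with h | h
    · refine ⟨x, fun j => ?_, rfl⟩
      split_ifs with hj
      · rw [hj, abs_of_nonneg h]
      · rfl
    · refine ⟨reflIso (b i) x, fun j => ?_, angProd_reflIso (hR i) x⟩
      rw [inner_reflIso]
      split_ifs with hj
      · rw [hj, abs_of_nonpos h]
      · rfl
  obtain ⟨x0, h0, e0⟩ := step 0 x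
  obtain ⟨x1, h1, e1⟩ := step 1 x0
  obtain ⟨x2, h2, e2⟩ := step 2 x1
  refine ⟨x2, fun j => ?_, by rw [e2, e1, e0]⟩
  rw [h2, h1, h0]
  fin_cases j <;> simp

lemma exists_angDeriv_eq_zero (hu : MFE u α) (hR : ∀ i x, u (reflIso (b i) x) = u x) :
    ∃ (i : Fin 3) (q : E3), ⟪b (i + 1), q⟫ ≠ 0 ∧ ⟪b (i + 2), q⟫ ≠ 0 ∧ angDeriv b i u q = 0 := by
  by_contra! hcon
  have hne : ∀ x, (∀ j, ⟪b j, x⟫ ≠ 0) → angProd b u x ≠ 0 := fun x hx =>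
    mul_ne_zero (mul_ne_zero (hcon 0 x (hx _) (hx _)) (hcon 1 x (hx _) (hx _)))
      (hcon 2 x (hx _) (hx _))
  have hs : SmoothOff u := hu.1
  have hPs : SmoothOff (angProd b u) := ((hs.angDeriv b 0).mul (hs.angDeriv b 1)).mul (hs.angDeriv b 2)
  set O : Set E3 := {x | ∀ j, 0 < ⟪b j, x⟫} with hO
  have hOconv : Convex ℝ O := by
    intro x hx y hy s t hs ht hst j
    rw [inner_add_right, real_inner_smul_right, real_inner_smul_right]
    rcases hs.eq_or_lt with rfl | hs
    · have : 0 < t := by linarith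
      have := mul_pos this (hy j)
      linarith
    · have h1 := mul_pos hs (hx j)
      have h2 := mul_nonneg ht (hy j).le
      linarith
  have hO0 : O ⊆ {(0 : E3)}ᶜ := by
    rintro x hx rfl
    simpa using hx 0
  have hcont : ContinuousOn (angProd b u) O := hPs.continuousOn.mono hO0
  have hOsign : ∀ x ∈ O, ∀ y ∈ O, 0 < angProd b u x → 0 < angProd b u y := by
    intro x hx y hy hxp
    by_contra hyp
    obtain ⟨z, hz, hz0⟩ := hOconv.isPreconnected.intermediate_value hy hx hcont
      ⟨not_lt.1 hyp, hxp.le⟩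
    exact hne z (fun j => (hz j).ne') hz0
  have hsign : ∀ x y : E3, (∀ j, ⟪b j, x⟫ ≠ 0) → (∀ j, ⟪b j, y⟫ ≠ 0) → 0 < angProd b u x →
      0 < angProd b u y := by
    intro x y hx hy hxp
    obtain ⟨x', hx', ex⟩ := exists_abs_inner hR x
    obtain ⟨y', hy', ey⟩ := exists_abs_inner hR y
    rw [← ex] at hxp
    rw [← ey]
    exact hOsign x' (fun j => by rw [hx']; exact abs_pos.2 (hx j)) y'
      (fun j => by rw [hy']; exact abs_pos.2 (hy j)) hxp
  have hplane : ∀ x, (∃ j, ⟪b j, x⟫ = 0) → angProd b u x = 0 := by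
    rintro x ⟨j, hj⟩
    have hfix : reflIso (b j) x = x :=
      reflIso_of_inner_eq_zero (basis_mem_S2 b j) ((real_inner_comm _ _).trans hj)
    have hz : ∀ m, m ≠ j → angDeriv b m u x = 0 := fun m hm => by
      have h1 := angDeriv_reflIso (hR j) m x
      rw [hfix, if_neg hm] at h1
      linarith
    rw [angProd]
    by_cases h0 : j = 0
    · rw [hz 1 (by rw [h0]; simp)]; ring
    · rw [hz 0 (Ne.symm h0)]; ring
  obtain ⟨ε, hε, hpos⟩ : ∃ ε : ℝ, ε ≠ 0 ∧ ∀ x, 0 ≤ ε * angProd b u x := by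
    set e : E3 := b 0 + b 1 + b 2 with he
    have heO : ∀ j, ⟪b j, e⟫ = 1 := by
      intro j
      rw [he]
      fin_cases j <;> simp [inner_add_right]
    rcases lt_or_gt_of_ne (hne e fun j => by rw [heO]; norm_num) with h | h
    · refine ⟨-1, by norm_num, fun x => ?_⟩
      by_cases hx : ∃ j, ⟪b j, x⟫ = 0
      · rw [hplane x hx, mul_zero]
      · push Not at hx
        by_contra hneg
        have := hsign x e hx (fun j => by rw [heO]; norm_num) (by linarith)
        linarith
    · refine ⟨1, by norm_num, fun x => ?_⟩
      by_cases hx : ∃ j, ⟪b j, x⟫ = 0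
      · rw [hplane x hx, mul_zero]
      · push Not at hx
        have := hsign e x (fun j => by rw [heO]; norm_num) hx h
        linarith
  have hint := hu.integral_angDeriv_prod b
  have hG : SmoothOff fun x => exp (2 * u x) * angProd b u x := hs.exp_two_mul.mul hPs
  have hcG : Continuous fun x => ε * (shellBump x * (exp (2 * u x) * angProd b u x)) :=
    continuous_const.mul hG.contDiff_shellBump_mul.continuous
  have hpi := hcG.integral_pos_of_hasCompactSupport_nonneg_nonzero
    (μ := (volume : Measure E3)) (hasCompactSupport_shellBump_mul _).mul_left
    (fun x => by
      have := mul_nonneg (mul_nonneg (shellBump_nonneg x) (exp_pos (2 * u x)).le) (hpos x)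
      show 0 ≤ _
      linarith)
    (x := ‖b 0 + b 1 + b 2‖⁻¹ • (b 0 + b 1 + b 2)) (by
      have hne0 : b 0 + b 1 + b 2 ≠ 0 := by
        intro h
        have h1 : ⟪b 0, b 0 + b 1 + b 2⟫ = 1 := by simp [inner_add_right]
        rw [h, inner_zero_right] at h1
        norm_num at h1
      have hn : ‖b 0 + b 1 + b 2‖⁻¹ ≠ 0 := by simpa using hne0
      rw [shellBump_eq_one (normalize_mem_S2 hne0), one_mul]
      refine mul_ne_zero hε (mul_ne_zero (exp_ne_zero _) (hne _ fun j => ?_))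
      rw [real_inner_smul_right]
      refine mul_ne_zero hn ?_
      fin_cases j <;> simp [inner_add_right])
  rw [integral_const_mul] at hpi
  have : ∫ x, shellBump x * (exp (2 * u x) * angProd b u x) = 0 := hint
  rw [this, mul_zero] at hpi
  exact lt_irrefl _ hpi

theorem exists_axiallySymmetric_of_even (hu : MFE u α) (he : ∀ x, u (-x) = u x) (hα : α ≤ 3) :
    ∃ p ∈ S2, AxiallySymmetric u p := by
  have hs : SmoothOff u := hu.1
  obtain ⟨p, hp, hmax⟩ := isCompact_S2.exists_isMaxOn
    ⟨_, basis_mem_S2 (EuclideanSpace.basisFun (Fin 3) ℝ) 0⟩ (hs.continuousOn.mono S2_subset)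
  have hcrit : fderiv ℝ u p = 0 := by
    refine IsLocalMax.fderiv_eq_zero ?_
    filter_upwards [isOpen_compl_singleton.mem_nhds (ne_zero_of_mem_S2 hp)] with x hx
    rw [hu.2.1.eq_normalize hx]
    exact hmax (normalize_mem_S2 hx)
  obtain ⟨b, rfl, hB⟩ := exists_basis_second_eq_zero hs hp
  have key : ∀ j k : Fin 3, ⟪b 2, b j⟫ = 0 → fderiv ℝ (fderiv ℝ u) (b 2) (b k) (b j) = 0 →
      (∀ v : E3, ⟪v, b 2⟫ = 0 → ⟪v, b j⟫ = 0 → v = ⟪b k, v⟫ • b k) →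
      ∀ x, u (reflIso (b j) x) = u x := by
    intro j k h2j hkj hv
    refine hu.2.1.eq_comp_reflIso (basis_mem_S2 b j) fun x hx =>
      eq_refl_of_critical hu he hα hp (basis_mem_S2 b j) h2j hcrit (fun v h1 h2 => ?_) hx
    rw [hv v h1 h2, map_smul, smul_apply, hkj, smul_zero]
  have hR0 := key 0 1 (by simp)
    (by rw [hs.second_symm (ne_zero_of_mem_S2 hp)]; exact hB) (fun v h1 h2 => by
      rw [real_inner_comm] at h1 h2
      have := basis_sum b v
      rw [h1, h2] at this
      simpa using this)
  have hR1 := key 1 0 (by simp) hB (fun v h1 h2 => by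
      rw [real_inner_comm] at h1 h2
      have := basis_sum b v
      rw [h1, h2] at this
      simpa using this)
  have hR2 : ∀ x, u (reflIso (b 2) x) = u x := by
    intro x
    have : reflIso (b 2) x = -reflIso (b 1) (reflIso (b 0) x) := by
      rw [basis_sum b (reflIso (b 2) x), basis_sum b (-reflIso (b 1) (reflIso (b 0) x))]
      simp only [inner_neg_right, inner_reflIso]
      simp
    rw [this, he, hR1, hR0]
  have hR : ∀ i x, u (reflIso (b i) x) = u x := by
    intro i
    fin_cases i
    exacts [hR0, hR1, hR2]
  obtain ⟨i, q, hj, hk, h0⟩ := exists_angDeriv_eq_zero hu hR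
  exact ⟨b i, basis_mem_S2 b i, axiallySymmetric_of_angDeriv_eq_zero hu he hα hR i hj hk h0⟩

lemma hausdorffMeasure_S2_lt_top : μH[2] S2 < ⊤ := by
  let b := EuclideanSpace.basisFun (Fin 3) ℝ
  let F : ℝ × ℝ → E3 := fun p => (sin p.1 * cos p.2) • b 0 + (sin p.1 * sin p.2) • b 1 + cos p.1 • b 2
  have hF : ContDiff ℝ 1 F := by fun_prop
  let K : Set (ℝ × ℝ) := Set.Icc 0 π ×ˢ Set.Icc (-π) π
  have hK : IsCompact K := isCompact_Icc.prod isCompact_Icc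
  obtain ⟨C, hC⟩ := LocallyLipschitzOn.exists_lipschitzOnWith_of_compact hK
    (hF.locallyLipschitz.locallyLipschitzOn (s := K))
  have hsub : S2 ⊆ F '' K := by
    intro x hx
    have hn := norm_sq_basis b x
    rw [mem_S2_iff.1 hx] at hn
    set z : ℂ := ⟨⟪b 0, x⟫, ⟪b 1, x⟫⟩ with hz
    have hsin : sin (arccos ⟪b 2, x⟫) = ‖z‖ := by
      rw [sin_arccos, Complex.norm_def, Complex.normSq_apply]
      congr 1
      simp only [hz]
      linarith
    have h1 := Complex.norm_mul_cos_arg z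
    have h2 := Complex.norm_mul_sin_arg z
    refine ⟨(arccos ⟪b 2, x⟫, z.arg), ⟨⟨arccos_nonneg _, arccos_le_pi _⟩,
      (Complex.neg_pi_lt_arg z).le, Complex.arg_le_pi z⟩, ?_⟩
    simp only [F]
    rw [hsin, h1, h2, cos_arccos (by nlinarith) (by nlinarith)]
    exact (basis_sum b x).symm
  refine (measure_mono hsub).trans_lt ((hC.hausdorffMeasure_image_le two_pos.le).trans_lt ?_)
  rw [hausdorffMeasure_prod_real]
  exact ENNReal.mul_lt_top (by simp) hK.measure_lt_top

lemma hausdorffMeasure_ball_inter_S2_pos {r : ℝ} (hx : x ∈ S2) (hr : 0 < r) :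
    0 < μH[2] (Metric.ball x r ∩ S2) := by
  obtain ⟨b, rfl⟩ := exists_basis_two hx
  let P : E3 → ℝ × ℝ := fun y => (⟪b 0, y⟫, ⟪b 1, y⟫)
  have hP : LipschitzWith 1 P := by
    refine LipschitzWith.of_dist_le_mul fun y z => ?_
    rw [NNReal.coe_one, one_mul, Prod.dist_eq, dist_eq_norm y z]
    have h : ∀ i : Fin 3, dist ⟪b i, y⟫ ⟪b i, z⟫ ≤ ‖y - z‖ := fun i => by
      rw [dist_eq_norm, ← inner_sub_right]
      simpa using norm_inner_le_norm (𝕜 := ℝ) (b i) (y - z)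
    exact max_le (h 0) (h 1)
  have h1 := hP.hausdorffMeasure_image_le two_pos.le (Metric.ball (b 2) r ∩ S2)
  rw [hausdorffMeasure_prod_real] at h1
  simp only [ENNReal.coe_one, ENNReal.one_rpow, one_mul] at h1
  refine lt_of_lt_of_le ?_ h1
  have hδ : 0 < min (1 / 2) (r / 2) := by positivity
  refine (Metric.measure_ball_pos volume (0 : ℝ × ℝ) hδ).trans_le (measure_mono ?_)
  rintro ⟨s, t⟩ hst
  rw [mem_ball_zero_iff, Prod.norm_def, max_lt_iff, lt_min_iff, lt_min_iff] at hst
  obtain ⟨⟨hs1, hs2⟩, ht1, ht2⟩ := hst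
  simp only [norm_eq_abs] at hs1 hs2 ht1 ht2
  have hs1' := sq_lt_sq' (by linarith [neg_abs_le s]) ((le_abs_self s).trans_lt hs1)
  have ht1' := sq_lt_sq' (by linarith [neg_abs_le t]) ((le_abs_self t).trans_lt ht1)
  have hs2' := sq_lt_sq' (by linarith [neg_abs_le s]) ((le_abs_self s).trans_lt hs2)
  have ht2' := sq_lt_sq' (by linarith [neg_abs_le t]) ((le_abs_self t).trans_lt ht2)
  have hc := sq_sqrt (show 0 ≤ 1 - s ^ 2 - t ^ 2 by nlinarith)
  have hc0 := sqrt_nonneg (1 - s ^ 2 - t ^ 2)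
  set c := √(1 - s ^ 2 - t ^ 2)
  have hnorm : ∀ p q m : ℝ, ‖p • b 0 + q • b 1 + m • b 2‖ ^ 2 = p ^ 2 + q ^ 2 + m ^ 2 := fun p q m => by
    rw [norm_sq_basis b]
    simp [inner_add_right, inner_smul_right]
  refine ⟨s • b 0 + t • b 1 + c • b 2, ⟨?_, ?_⟩, ?_⟩
  · rw [Metric.mem_ball, dist_eq_norm]
    have : s • b 0 + t • b 1 + c • b 2 - b 2 = s • b 0 + t • b 1 + (c - 1) • b 2 := by module
    rw [this]
    refine lt_of_pow_lt_pow_left₀ 2 hr.le ?_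
    rw [hnorm]
    nlinarith
  · rw [mem_S2_iff, ← sq_eq_sq₀ (norm_nonneg _) zero_le_one, hnorm]
    linarith
  · simp [P, inner_add_right, inner_smul_right]

open Filter Topology Set in
lemma tendsto_measureReal_Iic_add_Iio_atTop (κ : Measure ℝ) [IsFiniteMeasure κ] :
    Tendsto (fun r => κ.real (Iic r) + κ.real (Iio r)) atTop
      (𝓝 (κ.real univ + κ.real univ)) := by
  have h : Tendsto (fun r => κ.real (Iic r)) atTop (𝓝 (κ.real univ)) :=
    (ENNReal.tendsto_toReal (measure_ne_top κ _)).comp (tendsto_measure_Iic_atTop κ)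
  refine h.add (tendsto_of_tendsto_of_tendsto_of_le_of_le
    (h.comp (tendsto_atTop_add_const_right _ (-1) tendsto_id)) h (fun r => ?_)
    fun r => measureReal_mono Iio_subset_Iic_self)
  exact measureReal_mono (Iic_subset_Iio.2 (by simp))

open Filter Topology Set in
lemma tendsto_measureReal_Iic_add_Iio_nhdsGT (κ : Measure ℝ) [IsFiniteMeasure κ] (a : ℝ) :
    Tendsto (fun r => κ.real (Iic r) + κ.real (Iio r)) (𝓝[>] a)
      (𝓝 (κ.real (Iic a) + κ.real (Iic a))) := by
  have h1 : ⋂ r > a, Iic r = Iic a := by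
    ext t
    simp only [mem_iInter, mem_Iic]
    exact ⟨fun h => le_of_forall_gt_imp_ge_of_dense h, fun h r hr => h.trans hr.le⟩
  have h2 : ⋂ r > a, Iio r = Iic a := by
    ext t
    simp only [mem_iInter, mem_Iic, mem_Iio]
    exact ⟨fun h => le_of_forall_gt_imp_ge_of_dense fun r hr => (h r hr).le,
      fun h r hr => h.trans_lt hr⟩
  have t1 := tendsto_measure_biInter_gt (μ := κ) (s := Iic) (a := a)
    (fun r _ => nullMeasurableSet_Iic) (fun i j _ h => Iic_subset_Iic.2 h)
    ⟨a + 1, by simp, measure_ne_top κ _⟩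
  have t2 := tendsto_measure_biInter_gt (μ := κ) (s := Iio) (a := a)
    (fun r _ => nullMeasurableSet_Iio) (fun i j _ h => Iio_subset_Iio h)
    ⟨a + 1, by simp, measure_ne_top κ _⟩
  rw [h1] at t1
  rw [h2] at t2
  exact ((ENNReal.tendsto_toReal (measure_ne_top κ _)).comp t1).add
    ((ENNReal.tendsto_toReal (measure_ne_top κ _)).comp t2)

open Filter Topology Set in
lemma measure_eq_of_Iic_add_Iio {κ κ' : Measure ℝ} [IsFiniteMeasure κ] [IsFiniteMeasure κ'] {d : ℝ}
    (hu : κ.real univ = κ'.real univ)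
    (h : ∀ r, κ.real (Iic r) + κ.real (Iio r) = κ'.real (Iic r) + κ'.real (Iio r) + d) :
    κ = κ' := by
  have hd : d = 0 := by
    have := tendsto_nhds_unique (tendsto_measureReal_Iic_add_Iio_atTop κ)
      (by simpa only [h] using (tendsto_measureReal_Iic_add_Iio_atTop κ').add_const d)
    linarith
  refine Measure.ext_of_Iic _ _ fun a => ?_
  have := tendsto_nhds_unique (tendsto_measureReal_Iic_add_Iio_nhdsGT κ a)
    (by simpa only [h, hd, add_zero] using tendsto_measureReal_Iic_add_Iio_nhdsGT κ' a)
  exact (measureReal_eq_measureReal_iff).1 (by linarith)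

lemma measureReal_trichotomy (ν : Measure E3) [IsFiniteMeasure ν] (e : E3) (S : Set E3) :
    ν.real S = ν.real (S ∩ {x | 0 < ⟪x, e⟫}) + ν.real (S ∩ {x | ⟪x, e⟫ < 0}) +
      ν.real (S ∩ {x | ⟪x, e⟫ = 0}) := by
  have m1 : MeasurableSet {x : E3 | 0 < ⟪x, e⟫} := measurableSet_lt (by fun_prop) (by fun_prop)
  have m2 : MeasurableSet {x : E3 | ⟪x, e⟫ < 0} := measurableSet_lt (by fun_prop) (by fun_prop)
  rw [← measureReal_inter_add_sdiff (s := S) m1, ← measureReal_inter_add_sdiff (s := S \ _) m2,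
    ← add_assoc]
  congr 3
  · ext x
    simp only [Set.mem_inter_iff, Set.mem_sdiff, Set.mem_ofPred_eq, not_lt]
    exact ⟨fun h => ⟨h.1.1, h.2⟩, fun h => ⟨⟨h.1, h.2.le⟩, h.2⟩⟩
  · ext x
    simp only [Set.mem_inter_iff, Set.mem_sdiff, Set.mem_ofPred_eq, not_lt]
    exact ⟨fun h => ⟨h.1.1, le_antisymm h.1.2 h.2⟩, fun h => ⟨⟨h.1, h.2.le⟩, h.2.ge⟩⟩

/-- The central projection onto the affine plane `{x · e = 1}`. -/
noncomputable def gnomonic (e x : E3) : E3 := ⟪x, e⟫⁻¹ • x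

@[fun_prop]
lemma measurable_gnomonic (e : E3) : Measurable (gnomonic e) := by
  unfold gnomonic
  fun_prop

lemma inner_gnomonic (e x w : E3) : ⟪gnomonic e x, w⟫ = ⟪x, w⟫ / ⟪x, e⟫ := by
  rw [gnomonic, real_inner_smul_left]
  ring

lemma map_inner_gnomonic_eq {ν : Measure E3} [IsFiniteMeasure ν]
    (h : ∀ y : E3, ν {x | 0 < ⟪x, y⟫} = ν {x | ⟪x, y⟫ < 0}) (e w : E3) :
    (ν.restrict {x | 0 < ⟪x, e⟫}).map (fun x => ⟪gnomonic e x, w⟫) =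
      (ν.restrict {x | ⟪x, e⟫ < 0}).map (fun x => ⟪gnomonic e x, w⟫) := by
  have m1 : MeasurableSet {x : E3 | 0 < ⟪x, e⟫} := measurableSet_lt (by fun_prop) (by fun_prop)
  have m2 : MeasurableSet {x : E3 | ⟪x, e⟫ < 0} := measurableSet_lt (by fun_prop) (by fun_prop)
  have hm : Measurable fun x => ⟪gnomonic e x, w⟫ := by fun_prop
  have hp : ∀ s, MeasurableSet s → ((ν.restrict {x | 0 < ⟪x, e⟫}).map
      (fun x => ⟪gnomonic e x, w⟫)).real s = ν.real ({x | ⟪x, w⟫ / ⟪x, e⟫ ∈ s} ∩ {x | 0 < ⟪x, e⟫}) :=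
    fun s hs => by
      rw [map_measureReal_apply hm hs, measureReal_restrict_apply (hm hs)]
      simp only [inner_gnomonic, Set.preimage]
  have hn : ∀ s, MeasurableSet s → ((ν.restrict {x | ⟪x, e⟫ < 0}).map
      (fun x => ⟪gnomonic e x, w⟫)).real s = ν.real ({x | ⟪x, w⟫ / ⟪x, e⟫ ∈ s} ∩ {x | ⟪x, e⟫ < 0}) :=
    fun s hs => by
      rw [map_measureReal_apply hm hs, measureReal_restrict_apply (hm hs)]
      simp only [inner_gnomonic, Set.preimage]
  have hcompl : ∀ (κ : Measure ℝ) [IsFiniteMeasure κ] (r : ℝ),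
      κ.real (Set.Iic r) + κ.real (Set.Ioi r) = κ.real Set.univ := fun κ _ r => by
    rw [← Set.compl_Iic, measureReal_add_measureReal_compl measurableSet_Iic]
  set κ := (ν.restrict {x | 0 < ⟪x, e⟫}).map fun x => ⟪gnomonic e x, w⟫
  set κ' := (ν.restrict {x | ⟪x, e⟫ < 0}).map fun x => ⟪gnomonic e x, w⟫
  have hu : κ.real Set.univ = κ'.real Set.univ := by
    rw [hp _ .univ, hn _ .univ]
    simpa [Measure.real] using congrArg ENNReal.toReal (h e)
  refine measure_eq_of_Iic_add_Iio (d := ν.real ({x | 0 < ⟪x, w⟫} ∩ {x | ⟪x, e⟫ = 0}) -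
    ν.real ({x | ⟪x, w⟫ < 0} ∩ {x | ⟪x, e⟫ = 0})) hu fun r => ?_
  have key : ν.real {x | 0 < ⟪x, w - r • e⟫} = ν.real {x | ⟪x, w - r • e⟫ < 0} :=
    congrArg ENNReal.toReal (h _)
  have e1 : ν.real {x | 0 < ⟪x, w - r • e⟫} = κ.real (Set.Ioi r) + κ'.real (Set.Iio r) +
      ν.real ({x | 0 < ⟪x, w⟫} ∩ {x | ⟪x, e⟫ = 0}) := by
    rw [measureReal_trichotomy ν e, hp _ measurableSet_Ioi, hn _ measurableSet_Iio]
    refine congrArg₂ _ (congrArg₂ _ (congrArg ν.real ?_) (congrArg ν.real ?_))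
      (congrArg ν.real ?_) <;> ext x <;> simp only [Set.mem_inter_iff, Set.mem_ofPred_eq, Set.mem_Ioi, Set.mem_Iio,
      inner_sub_right, real_inner_smul_right, and_congr_left_iff] <;> intro hx
    · rw [lt_div_iff₀ hx, sub_pos]
    · rw [div_lt_iff_of_neg hx, sub_pos]
    · simp [hx]
  have e2 : ν.real {x | ⟪x, w - r • e⟫ < 0} = κ.real (Set.Iio r) + κ'.real (Set.Ioi r) +
      ν.real ({x | ⟪x, w⟫ < 0} ∩ {x | ⟪x, e⟫ = 0}) := by
    rw [measureReal_trichotomy ν e, hp _ measurableSet_Iio, hn _ measurableSet_Ioi]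
    refine congrArg₂ _ (congrArg₂ _ (congrArg ν.real ?_) (congrArg ν.real ?_))
      (congrArg ν.real ?_) <;> ext x <;> simp only [Set.mem_inter_iff, Set.mem_ofPred_eq, Set.mem_Ioi, Set.mem_Iio,
      inner_sub_right, real_inner_smul_right, and_congr_left_iff] <;> intro hx
    · rw [div_lt_iff₀ hx, sub_neg]
    · rw [lt_div_iff_of_neg hx, sub_neg]
    · simp [hx]
  linarith [hcompl κ r, hcompl κ' r]

lemma map_gnomonic_eq {ν : Measure E3} [IsFiniteMeasure ν]
    (h : ∀ y : E3, ν {x | 0 < ⟪x, y⟫} = ν {x | ⟪x, y⟫ < 0}) (e : E3) :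
    (ν.restrict {x | 0 < ⟪x, e⟫}).map (gnomonic e) =
      (ν.restrict {x | ⟪x, e⟫ < 0}).map (gnomonic e) := by
  refine Measure.ext_of_charFunDual (funext fun L => ?_)
  rw [charFunDual_eq_charFun_map_one, charFunDual_eq_charFun_map_one,
    Measure.map_map (by fun_prop) (by fun_prop), Measure.map_map (by fun_prop) (by fun_prop)]
  have hL : L ∘ gnomonic e =
      fun x => ⟪gnomonic e x, (InnerProductSpace.toDual ℝ E3).symm L⟫ := by
    ext x
    rw [real_inner_comm, InnerProductSpace.toDual_symm_apply]
    rfl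
  rw [hL, map_inner_gnomonic_eq h]

/-- A finite measure on the sphere for which opposite half-spheres have equal mass is even. -/
lemma measure_neg_eq_of_halfSpaces {ν : Measure E3} [IsFiniteMeasure ν] (hS : ∀ᵐ x ∂ν, x ∈ S2)
    (h : ∀ y : E3, ν {x | 0 < ⟪x, y⟫} = ν {x | ⟪x, y⟫ < 0}) {e : E3} {A : Set E3}
    (hA : MeasurableSet A) (hAe : ∀ x ∈ A, 0 < ⟪x, e⟫) : ν A = ν ((fun x => -x) ⁻¹' A) := by
  have m1 : MeasurableSet {x : E3 | 0 < ⟪x, e⟫} := measurableSet_lt (by fun_prop) (by fun_prop)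
  have m2 : MeasurableSet {x : E3 | ⟪x, e⟫ < 0} := measurableSet_lt (by fun_prop) (by fun_prop)
  have hN : Measurable fun p : E3 => ‖p‖⁻¹ • p := by fun_prop
  have hB := hN hA
  have hB' := (measurable_gnomonic e) hB
  have := congrArg (fun κ => κ ((fun p : E3 => ‖p‖⁻¹ • p) ⁻¹' A)) (map_gnomonic_eq h e)
  simp only [Measure.map_apply (measurable_gnomonic e) hB, Measure.restrict_apply hB'] at this
  refine Eq.trans (measure_congr ?_) (this.trans (measure_congr ?_))
  · filter_upwards [hS] with x hx
    have hx' : 0 < ⟪x, e⟫ → ‖gnomonic e x‖⁻¹ • gnomonic e x = x := fun hp => by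
      rw [gnomonic, norm_smul, mem_S2_iff.1 hx, smul_smul, norm_inv, norm_of_nonneg hp.le]
      field_simp
      simp
    refine propext ⟨fun hxA => ⟨?_, hAe x hxA⟩, fun ⟨h1, hp⟩ => ?_⟩
    · change ‖gnomonic e x‖⁻¹ • gnomonic e x ∈ A
      rwa [hx' (hAe x hxA)]
    · change ‖gnomonic e x‖⁻¹ • gnomonic e x ∈ A at h1
      rwa [hx' hp] at h1
  · filter_upwards [hS] with x hx
    have hx' : ⟪x, e⟫ < 0 → ‖gnomonic e x‖⁻¹ • gnomonic e x = -x := fun hp => by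
      have hp0 : ⟪x, e⟫ ≠ 0 := hp.ne
      rw [gnomonic, norm_smul, mem_S2_iff.1 hx, smul_smul, norm_inv, norm_of_nonpos hp.le,
        ← neg_one_smul ℝ x]
      congr 1
      field_simp
    refine propext ⟨fun ⟨h1, hp⟩ => ?_, fun hxA => ?_⟩
    · change ‖gnomonic e x‖⁻¹ • gnomonic e x ∈ A at h1
      rwa [hx' hp] at h1
    · have hp : ⟪x, e⟫ < 0 := by simpa using hAe _ hxA
      refine ⟨?_, hp⟩
      change ‖gnomonic e x‖⁻¹ • gnomonic e x ∈ A
      rwa [hx' hp]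

lemma measurable_inner_left (y : E3) : Measurable fun x : E3 => ⟪x, y⟫ := by fun_prop

lemma halfSphere_eq (y : E3) : halfSphere y = {x | 0 ≤ ⟪x, y⟫} ∩ S2 :=
  Set.inter_comm _ _

lemma halfSphere_neg_eq (y : E3) : halfSphere (-y) = {x | ⟪x, y⟫ ≤ 0} ∩ S2 := by
  simp [halfSphere_eq]

/-- The spherical measure with density `f`, as a measure on `ℝ³`. -/
noncomputable def sphereDensity (f : E3 → ℝ) : Measure E3 :=
  (μH[2].restrict S2).withDensity fun x => ENNReal.ofReal (f x)

lemma integrableOn_S2 (hf : ContinuousOn f S2) : IntegrableOn f S2 μH[2] :=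
  hf.integrableOn_of_subset_isCompact isCompact_S2 isCompact_S2.measurableSet subset_rfl
    hausdorffMeasure_S2_lt_top.ne

lemma isFiniteMeasure_sphereDensity (hf : ContinuousOn f S2) :
    IsFiniteMeasure (sphereDensity f) :=
  isFiniteMeasure_withDensity_ofReal (integrableOn_S2 hf).2

lemma sphereDensity_apply {s : Set E3} (hs : MeasurableSet s) :
    sphereDensity f s = ∫⁻ x in s ∩ S2, ENNReal.ofReal (f x) ∂μH[2] := by
  rw [sphereDensity, withDensity_apply _ hs, Measure.restrict_restrict hs]

lemma sphereDensity_apply_eq_ofReal {s : Set E3} (hs : MeasurableSet s) (hf : ContinuousOn f S2)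
    (h0 : ∀ x, 0 ≤ f x) :
    sphereDensity f s = ENNReal.ofReal (∫ x in s ∩ S2, f x ∂μH[2]) := by
  rw [sphereDensity_apply hs, ofReal_integral_eq_lintegral_ofReal
    ((integrableOn_S2 hf).mono_set Set.inter_subset_right) (Filter.Eventually.of_forall h0)]

lemma sphereDensity_half_eq (hf : ContinuousOn f S2) (h0 : ∀ x, 0 ≤ f x)
    (h : ∀ y ∈ S2, ∫ x in halfSphere y, f x ∂μH[2] = ∫ x in halfSphere (-y), f x ∂μH[2]) (y : E3) :
    sphereDensity f {x | 0 < ⟪x, y⟫} = sphereDensity f {x | ⟪x, y⟫ < 0} := by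
  have := isFiniteMeasure_sphereDensity hf
  have key : ∀ y ∈ S2,
      sphereDensity f {x | 0 < ⟪x, y⟫} = sphereDensity f {x | ⟪x, y⟫ < 0} := fun y hy => by
    have m1 : MeasurableSet {x : E3 | 0 ≤ ⟪x, y⟫} :=
      measurableSet_le measurable_const (measurable_inner_left y)
    have m2 : MeasurableSet {x : E3 | ⟪x, y⟫ ≤ 0} :=
      measurableSet_le (measurable_inner_left y) measurable_const
    have c1 : {x : E3 | 0 < ⟪x, y⟫} = {x | ⟪x, y⟫ ≤ 0}ᶜ := by ext; simp
    have c2 : {x : E3 | ⟪x, y⟫ < 0} = {x | 0 ≤ ⟪x, y⟫}ᶜ := by ext; simp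
    rw [c1, c2, measure_compl m1 (measure_ne_top _ _), measure_compl m2 (measure_ne_top _ _),
      sphereDensity_apply_eq_ofReal m1 hf h0, sphereDensity_apply_eq_ofReal m2 hf h0,
      ← halfSphere_eq, ← halfSphere_neg_eq, h y hy]
  obtain rfl | hy := eq_or_ne y 0
  · simp
  · have hn : 0 < ‖y‖⁻¹ := by positivity
    have := key _ (normalize_mem_S2 hy)
    have hlt : ∀ t : ℝ, ‖y‖⁻¹ * t < 0 ↔ t < 0 := fun t => by
      rw [← neg_pos, ← mul_neg, mul_pos_iff_of_pos_left hn, neg_pos]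
    simpa only [real_inner_smul_right, mul_pos_iff_of_pos_left hn, hlt] using this

lemma not_neg_lt_of_half_eq (hf : ContinuousOn f S2) (h0 : ∀ x, 0 ≤ f x)
    (h : ∀ y ∈ S2, ∫ x in halfSphere y, f x ∂μH[2] = ∫ x in halfSphere (-y), f x ∂μH[2])
    (hx : x ∈ S2) : ¬ f (-x) < f x := by
  intro hlt
  have := isFiniteMeasure_sphereDensity hf
  have hneg : ContinuousOn (fun y => f (-y)) S2 :=
    hf.comp continuousOn_neg fun y hy => neg_mem_S2 hy
  have hin : ContinuousOn (fun y : E3 => ⟪y, x⟫) S2 := by fun_prop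
  have hxx : 0 < ⟪x, x⟫ := by simp [mem_S2_iff.1 hx]
  have hev := ((hneg x hx).eventually_lt (hf x hx) hlt).and
    (continuousWithinAt_const.eventually_lt (hin x hx) hxx)
  obtain ⟨r, hr, hball⟩ := Metric.mem_nhdsWithin_iff.1 hev
  set A := Metric.ball x r ∩ S2
  have hA : MeasurableSet A := measurableSet_ball.inter isCompact_S2.measurableSet
  have hpre : MeasurableSet ((fun y : E3 => -y) ⁻¹' A) := measurable_neg hA
  have hS : ∀ᵐ y ∂(sphereDensity f), y ∈ S2 :=
    (withDensity_absolutelyContinuous _ _).ae_le (ae_restrict_mem isCompact_S2.measurableSet)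
  have hsym := measure_neg_eq_of_halfSpaces hS (sphereDensity_half_eq hf h0 h) (e := x) hA
    fun y hy => (hball hy).2
  have hs1 : A ∩ S2 = A := Set.inter_eq_left.2 Set.inter_subset_right
  have hs2 : (fun y : E3 => -y) ⁻¹' A ∩ S2 = (fun y : E3 => -y) ⁻¹' A :=
    Set.inter_eq_left.2 fun y hy => by simpa using neg_mem_S2 hy.2
  have hmp : MeasurePreserving (fun y : E3 => -y) μH[2] μH[2] :=
    (LinearIsometryEquiv.neg ℝ (E := E3)).toIsometryEquiv.measurePreserving_hausdorffMeasure 2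
  have hcomp := hmp.setLIntegral_comp_preimage_emb (MeasurableEquiv.neg E3).measurableEmbedding
    (fun y => ENNReal.ofReal (f (-y))) A
  have hfin : sphereDensity f ((fun y : E3 => -y) ⁻¹' A) ≠ ⊤ := measure_ne_top _ _
  rw [sphereDensity_apply hA, sphereDensity_apply hpre, hs1, hs2] at hsym
  rw [sphereDensity_apply hpre, hs2] at hfin
  simp only [neg_neg] at hcomp
  rw [hcomp] at hsym hfin
  refine (lintegral_strict_mono ?_ ?_ hfin ?_).ne' hsym
  · rw [Ne, Measure.restrict_eq_zero]
    exact (hausdorffMeasure_ball_inter_S2_pos hx hr).ne'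
  · exact ENNReal.measurable_ofReal.comp_aemeasurable
      (((hf.mono Set.inter_subset_right).aestronglyMeasurable hA).aemeasurable)
  · filter_upwards [ae_restrict_mem hA] with y hy
    exact (ENNReal.ofReal_lt_ofReal_iff ((h0 _).trans_lt (hball hy).1)).2 (hball hy).1

lemma even_of_half_eq (hu : MFE u α)
    (h : ∀ y ∈ S2, ∫ x in halfSphere y, Real.exp (2 * u x) ∂μH[2] =
      ∫ x in halfSphere (-y), Real.exp (2 * u x) ∂μH[2]) (x : E3) : u (-x) = u x := by
  have hc : ContinuousOn (fun x => Real.exp (2 * u x)) S2 :=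
    ((hu.1.continuousOn.mono S2_subset).const_mul 2).rexp
  have hS : ∀ y ∈ S2, u y ≤ u (-y) := fun y hy => by
    simpa using not_neg_lt_of_half_eq hc (fun _ => (exp_pos _).le) h hy
  obtain rfl | hx := eq_or_ne x 0
  · simp
  · have hn := normalize_mem_S2 hx
    rw [hu.2.1.eq_normalize hx, hu.2.1.eq_normalize (neg_ne_zero.2 hx), norm_neg, smul_neg]
    exact le_antisymm (by simpa using hS _ (neg_mem_S2 hn)) (hS _ hn)

end

theorem stmt2 (α : ℝ) (hα1 : 2 < α) (hα2 : α ≤ 3) (u : E3 → ℝ) (hu : MFE u α)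
    (harea : ∀ y ∈ S2, (∫ x in halfSphere y, Real.exp (2 * u x) ∂μH[2]) =
      ∫ x in halfSphere (-y), Real.exp (2 * u x) ∂μH[2]) :
    ∃ p ∈ S2, AxiallySymmetric u p :=
  exists_axiallySymmetric_of_even hu (even_of_half_eq hu harea) hα2
end

section
/- Let α > 0 and let u ∈ C^∞(S²) be a solution of −Δu + α = e^{2u} on S². Let q be a critical point of u and z ∈ T_qS² a unit eigenvector of the Hessian D²u(q). Set y = q × z, v = u ∘ R_y and w = u − v. If w is not identically zero, then w vanishes at q to order at least 3; that is, the first nonvanishing term in the Taylor expansion of w at q has degree ≥ 3. -/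
open MeasureTheory Real
open scoped RealInnerProductSpace ContDiff

lemma inner_eq_coords (a b : E3) : ⟪a, b⟫ = b 0 * a 0 + b 1 * a 1 + b 2 * a 2 := by
  simp [PiLp.inner_apply, Fin.sum_univ_three]

lemma cross_coords (a b : E3) : cross a b 0 = a 1 * b 2 - a 2 * b 1 ∧
    cross a b 1 = a 2 * b 0 - a 0 * b 2 ∧ cross a b 2 = a 0 * b 1 - a 1 * b 0 := by
  simp [cross, cross_apply]

lemma inner_cross_left (a b : E3) : ⟪a, cross a b⟫ = 0 := by
  obtain ⟨h0, h1, h2⟩ := cross_coords a b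
  rw [inner_eq_coords, h0, h1, h2]; ring

lemma inner_cross_right (a b : E3) : ⟪b, cross a b⟫ = 0 := by
  obtain ⟨h0, h1, h2⟩ := cross_coords a b
  rw [inner_eq_coords, h0, h1, h2]; ring

lemma inner_cross_self (a b : E3) :
    ⟪cross a b, cross a b⟫ = ⟪a, a⟫ * ⟪b, b⟫ - ⟪a, b⟫ ^ 2 := by
  obtain ⟨h0, h1, h2⟩ := cross_coords a b
  simp only [inner_eq_coords, h0, h1, h2]; ring

/-- In `ℝ³`, a vector is recovered from its components along an orthonormal triple. -/
lemma eq_sum_of_orthonormal {b : Fin 3 → E3} (hb : Orthonormal ℝ b) (x : E3) :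
    x = ⟪b 0, x⟫ • b 0 + ⟪b 1, x⟫ • b 1 + ⟪b 2, x⟫ • b 2 := by
  have hspan : ⊤ ≤ Submodule.span ℝ (Set.range b) :=
    (hb.linearIndependent.span_eq_top_of_card_eq_finrank (by simp)).ge
  have h := (OrthonormalBasis.mk hb hspan).sum_repr' x
  simpa [Fin.sum_univ_three] using h.symm

/-- The reflection `Refl y` as a continuous linear map. -/
noncomputable def reflCLM (y : E3) : E3 →L[ℝ] E3 :=
  ContinuousLinearMap.id ℝ E3 - (2 : ℝ) • (innerSL ℝ y).smulRight y

lemma reflCLM_apply (y x : E3) : reflCLM y x = Refl y x := by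
  simp [reflCLM, Refl, smul_smul, real_inner_comm]

/-- The gradient of a radially constant function vanishes along the ray of a critical point. -/
lemma Hom0.fderiv_smul_eq_zero {u : E3 → ℝ} (hu : Hom0 u) {q : E3} (hq : fderiv ℝ u q = 0)
    {t : ℝ} (ht : 0 < t) : fderiv ℝ u (t • q) = 0 := by
  have h1 : (fun x => u (t • x)) = u := funext fun x => hu x t ht
  have h2 : fderiv ℝ (fun x => u (t • x)) q = t • fderiv ℝ u (t • q) := fderiv_comp_smul _
  rw [h1, hq] at h2
  exact (smul_eq_zero.mp h2.symm).resolve_left ht.ne'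

/-- The Hessian of a radially constant function at a critical point kills the radial direction. -/
lemma Hom0.fderiv_fderiv_apply_self {u : E3 → ℝ} (hu : Hom0 u) {q : E3}
    (hd : DifferentiableAt ℝ (fderiv ℝ u) q) (hq : fderiv ℝ u q = 0) :
    fderiv ℝ (fderiv ℝ u) q q = 0 := by
  have hray : HasDerivAt (fun t : ℝ => t • q) q 1 := by
    simpa using (hasDerivAt_id (1 : ℝ)).smul_const q
  have hd' : HasFDerivAt (fderiv ℝ u) (fderiv ℝ (fderiv ℝ u) q) ((1 : ℝ) • q) := by
    simpa using hd.hasFDerivAt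
  have h1 := hd'.comp_hasDerivAt (1 : ℝ) hray
  have h2 : HasDerivAt (fderiv ℝ u ∘ fun t : ℝ => t • q) 0 1 := by
    refine (hasDerivAt_const (1 : ℝ) (0 : E3 →L[ℝ] ℝ)).congr_of_eventuallyEq ?_
    filter_upwards [lt_mem_nhds (zero_lt_one' ℝ)] with t ht
    exact hu.fderiv_smul_eq_zero hq ht
  exact h1.unique h2

theorem stmt10 (α : ℝ) (hα : 0 < α) (u : E3 → ℝ) (hu : MFE u α)
    (q z : E3) (hq : q ∈ S2) (hcrit : fderiv ℝ u q = 0)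
    (hzq : ⟪z, q⟫ = 0) (hz1 : ‖z‖ = 1) (heig : HessEigen u q z)
    (y : E3) (hy : y = cross q z)
    (v w : E3 → ℝ) (hv : v = fun x => u (Refl y x)) (hw : w = fun x => u x - v x)
    (hw0 : ∃ x ∈ S2, w x ≠ 0) :
    ∀ k : ℕ, k < 3 → iteratedFDeriv ℝ k w q = 0 := by
  have hqq : ⟪q, q⟫ = 1 := by
    have : ‖q‖ = 1 := by simpa [S2] using hq
    rw [real_inner_self_eq_norm_sq, this, one_pow]
  have hzz : ⟪z, z⟫ = 1 := by rw [real_inner_self_eq_norm_sq, hz1, one_pow]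
  have hqz : ⟪q, z⟫ = 0 := by rw [real_inner_comm, hzq]
  have hqy : ⟪q, y⟫ = 0 := hy ▸ inner_cross_left q z
  have hzy : ⟪z, y⟫ = 0 := hy ▸ inner_cross_right q z
  have hyq : ⟪y, q⟫ = 0 := by rw [real_inner_comm, hqy]
  have hyz : ⟪y, z⟫ = 0 := by rw [real_inner_comm, hzy]
  have hyy : ⟪y, y⟫ = 1 := by rw [hy, inner_cross_self, hqq, hzz, hqz]; norm_num
  have horth : Orthonormal ℝ ![q, z, y] := by
    rw [orthonormal_iff_ite]
    intro i j
    fin_cases i <;> fin_cases j <;> 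
      simp [hqq, hzz, hyy, hqz, hzq, hqy, hyq, hzy, hyz, -inner_self_eq_norm_sq_to_K]
  have hq0 : q ≠ 0 := by rintro rfl; simp at hqq
  obtain ⟨hsmooth, hhom, -⟩ := hu
  have hcd : ∀ x : E3, x ≠ 0 → ContDiffAt ℝ ∞ u x := fun x hx =>
    hsmooth.contDiffAt (isOpen_compl_singleton.mem_nhds hx)
  have hdu : ∀ x : E3, x ≠ 0 → DifferentiableAt ℝ u x := fun x hx =>
    (hcd x hx).differentiableAt (by simp)
  have hd2 : DifferentiableAt ℝ (fderiv ℝ u) q :=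
    ((hcd q hq0).fderiv_right (m := 1) (by norm_cast)).differentiableAt (by simp)
  have hRq : reflCLM y q = q := by rw [reflCLM_apply, Refl, hqy]; simp
  have hw' : w = fun x => u x - u (reflCLM y x) := by
    rw [hw, hv]; funext x; rw [reflCLM_apply]
  have hne : ∀ᶠ x in nhds q, x ≠ 0 ∧ reflCLM y x ≠ 0 := by
    exact (eventually_ne_nhds hq0).and <| (reflCLM y).continuous.continuousAt.eventually_ne (by rwa [hRq])
  have hfw : fderiv ℝ w =ᶠ[nhds q]
      fun x => fderiv ℝ u x - (fderiv ℝ u (reflCLM y x)).comp (reflCLM y) := by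
    filter_upwards [hne] with x hx
    rw [hw']
    exact ((hdu x hx.1).hasFDerivAt.sub
      ((hdu _ hx.2).hasFDerivAt.comp x (reflCLM y).hasFDerivAt)).fderiv
  have hffw : ∀ a b : E3, fderiv ℝ (fderiv ℝ w) q a b = fderiv ℝ (fderiv ℝ u) q a b
      - fderiv ℝ (fderiv ℝ u) q (reflCLM y a) (reflCLM y b) := by
    intro a b
    have h1 : HasFDerivAt (fderiv ℝ u) (fderiv ℝ (fderiv ℝ u) q) (reflCLM y q) := by
      rw [hRq]; exact hd2.hasFDerivAt
    have h2 := (h1.comp q (reflCLM y).hasFDerivAt).clm_comp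
      (hasFDerivAt_const (reflCLM y) q)
    have h3 : fderiv ℝ (fun x => fderiv ℝ u x - (fderiv ℝ u (reflCLM y x)).comp (reflCLM y)) q = _ :=
      (hd2.hasFDerivAt.sub h2).fderiv
    rw [hfw.fderiv_eq, h3]
    simp
  have hsymm : ∀ a b : E3,
      fderiv ℝ (fderiv ℝ u) q a b = fderiv ℝ (fderiv ℝ u) q b a := fun a b =>
    ((hcd q hq0).isSymmSndFDerivAt (by simp; norm_cast)).eq a b
  have hBqy : fderiv ℝ (fderiv ℝ u) q q y = 0 := by
    rw [hhom.fderiv_fderiv_apply_self hd2 hcrit]; simp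
  have hBzy : fderiv ℝ (fderiv ℝ u) q z y = 0 := by
    obtain ⟨lam, hlam⟩ := heig
    simpa [iteratedFDeriv_two_apply, hzy] using hlam y hyq
  have hRz : reflCLM y z = z := by rw [reflCLM_apply, Refl, hzy]; simp
  have hRy : reflCLM y y = -y := by rw [reflCLM_apply, Refl, hyy]; module
  intro k hk
  ext m
  interval_cases k
  · simp [hw', hRq]
  · rw [iteratedFDeriv_one_apply, hfw.eq_of_nhds]
    simp [hRq, hcrit]
  · rw [iteratedFDeriv_two_apply, hffw, eq_sum_of_orthonormal horth (m 0),
      eq_sum_of_orthonormal horth (m 1)]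
    simp [hRq, hRz, hRy, hBqy, hBzy, hsymm y q, hsymm y z]
end
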